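/- arXiv:2405.17583 — 8 statements merged into one kernel-verified Lean document; each statement's English description precedes it below -/
import Mathlib

section
/- Let x be a random vector in ℝ^d with E‖x‖⁴ < ∞ and H := E[x xᵀ]. Then for every positive semidefinite d×d matrix A, E[x xᵀ A x xᵀ] ⪰ H A H; that is, the operator A ↦ E[x xᵀ A x xᵀ] − H A H is a PSD mapping. -/
open MeasureTheory Matrix

/-- Entrywise expectation of a matrix-valued random variable. -/
noncomputable def expMatrix {Ω : Type*} [MeasurableSpace Ω] {d : ℕ}
    (μ : Measure Ω) (f : Ω → Matrix (Fin d) (Fin d) ℝ) : Matrix (Fin d) (Fin d) ℝ :=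
  Matrix.of fun i j => ∫ ω, f ω i j ∂μ

lemma expMatrix_bilin {Ω : Type*} [MeasurableSpace Ω] {d : ℕ}
    (μ : Measure Ω) (M : Ω → Matrix (Fin d) (Fin d) ℝ)
    (hM : ∀ i j, Integrable (fun ω => M ω i j) μ) (a b : Fin d → ℝ) :
    Integrable (fun ω => a ⬝ᵥ M ω *ᵥ b) μ ∧
    a ⬝ᵥ expMatrix μ M *ᵥ b = ∫ ω, a ⬝ᵥ M ω *ᵥ b ∂μ := by
  have h1 : ∀ i j, Integrable (fun ω => a i * (M ω i j * b j)) μ :=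
    fun i j => ((hM i j).mul_const _).const_mul _
  have h2 : ∀ i, Integrable (fun ω => ∑ j, a i * (M ω i j * b j)) μ :=
    fun i => integrable_finsetSum _ fun j _ => h1 i j
  simp only [dotProduct, mulVec, Finset.mul_sum, expMatrix, Matrix.of_apply]
  refine ⟨integrable_finsetSum _ fun i _ => h2 i, ?_⟩
  rw [integral_finsetSum _ fun i _ => h2 i]
  refine Finset.sum_congr rfl fun i _ => ?_
  rw [integral_finsetSum _ fun j _ => h1 i j]
  refine Finset.sum_congr rfl fun j _ => ?_
  rw [integral_const_mul, integral_mul_const]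

lemma abs_mul_le_sum_sq {d : ℕ} (y : Fin d → ℝ) (i j : Fin d) :
    |y i * y j| ≤ ∑ k, y k ^ 2 := by
  have hi : y i ^ 2 ≤ ∑ k, y k ^ 2 :=
    Finset.single_le_sum (f := fun k => y k ^ 2) (fun k _ => sq_nonneg _) (Finset.mem_univ i)
  have hj : y j ^ 2 ≤ ∑ k, y k ^ 2 :=
    Finset.single_le_sum (f := fun k => y k ^ 2) (fun k _ => sq_nonneg _) (Finset.mem_univ j)
  rw [abs_le]
  constructor <;> nlinarith [sq_nonneg (y i - y j), sq_nonneg (y i + y j)]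

/-- For a random vector `x` with `E‖x‖⁴ < ∞` and `H := E[x xᵀ]`, for every
PSD matrix `A` one has `E[x xᵀ A x xᵀ] ⪰ H A H`, i.e. `A ↦ E[x xᵀ A x xᵀ] − H A H`
is a PSD mapping. -/
theorem fourth_moment_minus_HAH_psd_mapping {d : ℕ} {Ω : Type*} [MeasurableSpace Ω]
    (μ : Measure Ω) [IsProbabilityMeasure μ]
    (x : Ω → Fin d → ℝ) (hmeas : Measurable x)
    (hx4 : Integrable (fun ω => (∑ i, x ω i ^ 2) ^ 2) μ)
    (H : Matrix (Fin d) (Fin d) ℝ)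
    (hH : H = expMatrix μ fun ω => vecMulVec (x ω) (x ω))
    (A : Matrix (Fin d) (Fin d) ℝ) (hA : A.PosSemidef) :
    ((expMatrix μ fun ω => (x ω ⬝ᵥ A *ᵥ x ω) • vecMulVec (x ω) (x ω))
      - H * A * H).PosSemidef := by
  have hxi : ∀ i, Measurable fun ω => x ω i := fun i => (measurable_pi_apply i).comp hmeas
  have int2 : ∀ i j, Integrable (fun ω => x ω i * x ω j) μ := by
    intro i j
    refine Integrable.mono' ((integrable_const (1 : ℝ)).add hx4)
      ((hxi i).mul (hxi j)).aestronglyMeasurable (Filter.Eventually.of_forall fun ω => ?_)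
    have := abs_mul_le_sum_sq (x ω) i j
    simp only [Real.norm_eq_abs, Pi.add_apply]
    nlinarith [sq_nonneg ((∑ k, x ω k ^ 2) - 1), sq_nonneg (∑ k, x ω k ^ 2)]
  have int4 : ∀ i j k l, Integrable (fun ω => (x ω k * x ω l) * (x ω i * x ω j)) μ := by
    intro i j k l
    refine Integrable.mono' hx4
      (((hxi k).mul (hxi l)).mul ((hxi i).mul (hxi j))).aestronglyMeasurable
      (Filter.Eventually.of_forall fun ω => ?_)
    rw [Real.norm_eq_abs, abs_mul, sq]
    exact mul_le_mul (abs_mul_le_sum_sq (x ω) k l) (abs_mul_le_sum_sq (x ω) i j)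
      (abs_nonneg _) (Finset.sum_nonneg fun k _ => sq_nonneg _)
  have intH : ∀ i j, Integrable (fun ω => vecMulVec (x ω) (x ω) i j) μ := by
    intro i j
    simpa only [vecMulVec_apply] using int2 i j
  have intQ : ∀ i j, Integrable
      (fun ω => ((x ω ⬝ᵥ A *ᵥ x ω) • vecMulVec (x ω) (x ω)) i j) μ := by
    intro i j
    have h : Integrable (fun ω => ∑ k, ∑ l, A k l * ((x ω k * x ω l) * (x ω i * x ω j))) μ :=
      integrable_finsetSum _ fun k _ => integrable_finsetSum _ fun l _ =>
        (int4 i j k l).const_mul _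
    refine h.congr (Filter.Eventually.of_forall fun ω => ?_)
    simp only [Matrix.smul_apply, vecMulVec_apply, smul_eq_mul, dotProduct, mulVec,
      Finset.mul_sum, Finset.sum_mul]
    refine Finset.sum_congr rfl fun k _ => Finset.sum_congr rfl fun l _ => ?_
    ring
  have hAT : Aᵀ = A := by
    have := hA.1
    rwa [Matrix.IsHermitian, conjTranspose_eq_transpose_of_trivial] at this
  have hHT : Hᵀ = H := by
    rw [hH]
    ext i j
    simp only [expMatrix, transpose_apply, Matrix.of_apply, vecMulVec_apply]
    simp only [mul_comm]
  refine Matrix.PosSemidef.of_dotProduct_mulVec_nonneg ?_ fun v => ?_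
  · rw [Matrix.IsHermitian, conjTranspose_eq_transpose_of_trivial, transpose_sub,
      transpose_mul, transpose_mul, hAT, hHT, ← Matrix.mul_assoc]
    congr 1
    ext i j
    simp only [expMatrix, transpose_apply, Matrix.of_apply, Matrix.smul_apply, vecMulVec_apply,
      mul_comm (x _ i)]
  · rw [star_trivial, sub_mulVec, dotProduct_sub]
    obtain ⟨i1, e1⟩ := expMatrix_bilin μ _ intQ v v
    set m := H *ᵥ v with hm
    obtain ⟨i2, e2⟩ := expMatrix_bilin μ _ intH v (A *ᵥ m)
    rw [← hH] at e2
    have e3 : v ⬝ᵥ H *ᵥ (A *ᵥ m) = m ⬝ᵥ A *ᵥ m := by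
      rw [dotProduct_mulVec v H, ← mulVec_transpose, hHT]
    have e4 : v ⬝ᵥ (H * A * H) *ᵥ v = m ⬝ᵥ A *ᵥ m := by
      rw [← e3, hm, mulVec_mulVec, mulVec_mulVec, Matrix.mul_assoc]
    have key : 0 ≤ ∫ ω, (v ⬝ᵥ ((x ω ⬝ᵥ A *ᵥ x ω) • vecMulVec (x ω) (x ω)) *ᵥ v
        - 2 * (v ⬝ᵥ vecMulVec (x ω) (x ω) *ᵥ (A *ᵥ m)) + m ⬝ᵥ A *ᵥ m) ∂μ := by
      refine integral_nonneg fun ω => ?_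
      have h := hA.dotProduct_mulVec_nonneg ((v ⬝ᵥ x ω) • x ω - m)
      have hs : m ⬝ᵥ A *ᵥ x ω = x ω ⬝ᵥ A *ᵥ m := by
        rw [dotProduct_mulVec, ← mulVec_transpose, hAT, dotProduct_comm]
      simp only [star_trivial, mulVec_sub, mulVec_smul, dotProduct_sub, sub_dotProduct,
        smul_dotProduct, dotProduct_smul, smul_eq_mul, hs] at h
      simp only [Pi.zero_apply, smul_mulVec, vecMulVec_mulVec, dotProduct_smul, smul_eq_mul,
        op_smul_eq_smul, dotProduct_comm (x ω) v]
      linarith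
    have i3 : Integrable (fun ω => v ⬝ᵥ ((x ω ⬝ᵥ A *ᵥ x ω) • vecMulVec (x ω) (x ω)) *ᵥ v
        - 2 * (v ⬝ᵥ vecMulVec (x ω) (x ω) *ᵥ (A *ᵥ m))) μ := i1.sub (i2.const_mul 2)
    rw [integral_add i3 (integrable_const _),
      integral_sub i1 (i2.const_mul 2), integral_const_mul, ← e1, ← e2, e3] at key
    simp only [integral_const, probReal_univ, one_smul] at key
    rw [e4]
    linarith
end

section
/- For any two positive semidefinite d×d real matrices H and A, it holds that H A H ⪯ tr(H A) · H. -/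
open Matrix

lemma trace_smul_one_sub_aux {d : ℕ} (D : Matrix (Fin d) (Fin d) ℝ) :
    ((Dᴴ * D).trace • (1 : Matrix (Fin d) (Fin d) ℝ) - Dᴴ * D).PosSemidef := by
  refine .of_dotProduct_mulVec_nonneg ?_ (fun x => ?_)
  · exact (isHermitian_one.smul (by simp [IsSelfAdjoint])).sub (isHermitian_conjTranspose_mul_self D)
  · have h1 : star x ⬝ᵥ (Dᴴ * D) *ᵥ x = ∑ i, (∑ j, D i j * x j) ^ 2 := by
      rw [← mulVec_mulVec, dotProduct_mulVec, ← star_mulVec]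
      simp [dotProduct, mulVec, sq]
    have h2 : (Dᴴ * D).trace = ∑ i, ∑ j, D i j ^ 2 := by
      rw [Finset.sum_comm]
      simp [trace, mul_apply, sq]
    have h3 : star x ⬝ᵥ x = ∑ j, x j ^ 2 := by simp [dotProduct, sq]
    rw [sub_mulVec, dotProduct_sub, h1, smul_mulVec, one_mulVec, dotProduct_smul, h2, h3,
      smul_eq_mul, Finset.sum_mul, sub_nonneg]
    exact Finset.sum_le_sum fun i _ => Finset.sum_mul_sq_le_sq_mul_sq _ _ _

open scoped MatrixOrder in
lemma exists_factor_aux {d : ℕ} (H : Matrix (Fin d) (Fin d) ℝ) (hH : H.PosSemidef) :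
    ∃ B : Matrix (Fin d) (Fin d) ℝ, H = Bᴴ * B :=
  CStarAlgebra.nonneg_iff_eq_star_mul_self.mp hH.nonneg

/-- For any two PSD `d×d` real matrices `H` and `A`,
`H A H ⪯ tr(H A) · H`. -/
theorem HAH_le_trace_smul_H {d : ℕ} (H A : Matrix (Fin d) (Fin d) ℝ)
    (hH : H.PosSemidef) (hA : A.PosSemidef) :
    ((H * A).trace • H - H * A * H).PosSemidef := by
  obtain ⟨B, rfl⟩ := exists_factor_aux H hH
  obtain ⟨C, rfl⟩ := exists_factor_aux A hA
  have h := (trace_smul_one_sub_aux (C * Bᴴ)).conjTranspose_mul_mul_same B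
  have ht : ((C * Bᴴ)ᴴ * (C * Bᴴ)).trace = (Bᴴ * B * (Cᴴ * C)).trace := by
    rw [conjTranspose_mul, conjTranspose_conjTranspose, ← Matrix.mul_assoc, trace_mul_comm]
    simp only [Matrix.mul_assoc]
  rw [ht] at h
  convert h using 1
  simp [Matrix.mul_sub, Matrix.sub_mul, Matrix.mul_assoc]
end

section
/- Let H be a positive definite d×d real matrix with largest eigenvalue λ₁ and let 0 < η < 1/λ₁. Then the linear map 𝒯̃ on symmetric d×d matrices defined by 𝒯̃(A) = H A + A H − η H A H is bijective, its inverse is given by 𝒯̃⁻¹(A) = η Σ_{t=0}^{∞} (I − ηH)^t A (I − ηH)^t (the series converging), and 𝒯̃⁻¹ is a PSD mapping: if A is positive semidefinite then so is 𝒯̃⁻¹(A). -/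
open Matrix

lemma aux_summable {d : ℕ} (U V D A : Matrix (Fin d) (Fin d) ℝ) (c : Fin d → ℝ)
    (hVU : V * U = 1) (hUV : U * V = 1) (hD : D = U * diagonal c * V) (hc0 : ∀ i, 0 ≤ c i)
    (hc1 : ∀ i, c i < 1) : Summable fun t : ℕ => D ^ t * A * D ^ t := by
  have hp : ∀ t : ℕ, D ^ t = U * diagonal (fun i => c i ^ t) * V := by
    intro t
    induction t with
    | zero => simp [hUV]
    | succ t ih =>
      rw [pow_succ, ih, hD]
      calc U * diagonal (fun i => c i ^ t) * V * (U * diagonal c * V)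
          = U * diagonal (fun i => c i ^ t) * (V * U) * diagonal c * V := by
            simp only [Matrix.mul_assoc]
        _ = _ := by
            rw [hVU, Matrix.mul_one, Matrix.mul_assoc U, diagonal_mul_diagonal]
            simp only [pow_succ]
  have hs : Summable fun t : ℕ =>
      diagonal (fun i => c i ^ t) * (V * A * U) * diagonal (fun i => c i ^ t) := by
    refine Pi.summable.2 fun i => Pi.summable.2 fun j => ?_
    have : Summable fun t : ℕ => (c i * c j) ^ t * (V * A * U) i j :=
      (summable_geometric_of_lt_one (mul_nonneg (hc0 i) (hc0 j))
        (mul_lt_one_of_nonneg_of_lt_one_left (hc0 i) (hc1 i) (hc1 j).le)).mul_right _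
    refine this.congr fun t => ?_
    rw [mul_diagonal, diagonal_mul, mul_pow]
    ring
  refine ((hs.mul_left U).mul_right V).congr fun t => ?_
  rw [hp]
  simp only [Matrix.mul_assoc]

lemma aux_summable_H {d : ℕ} (H : Matrix (Fin d) (Fin d) ℝ)
    (hH : H.PosDef) (lam1 : ℝ)
    (hlam : IsGreatest (Set.range hH.isHermitian.eigenvalues) lam1)
    (η : ℝ) (hη0 : 0 < η) (hη1 : η < 1 / lam1) (A : Matrix (Fin d) (Fin d) ℝ) :
    Summable fun t : ℕ => (1 - η • H) ^ t * A * (1 - η • H) ^ t := by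
  have hpos := hH.eigenvalues_pos
  have hl : 0 < lam1 := by
    obtain ⟨i, hi⟩ := hlam.1
    rw [← hi]; exact hpos i
  have hηl : η * lam1 < 1 := (lt_div_iff₀ hl).1 hη1
  have hspec := hH.isHermitian.spectral_theorem
  rw [Unitary.conjStarAlgAut_apply] at hspec
  set U : Matrix (Fin d) (Fin d) ℝ := (hH.isHermitian.eigenvectorUnitary : Matrix (Fin d) (Fin d) ℝ) with hU
  have hVU : star U * U = 1 := Unitary.coe_star_mul_self _
  have hUV : U * star U = 1 := Unitary.coe_mul_star_self _
  refine aux_summable U (star U) _ A (fun i => 1 - η * hH.isHermitian.eigenvalues i)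
    hVU hUV ?_ ?_ ?_
  · have : diagonal (fun i => 1 - η * hH.isHermitian.eigenvalues i)
        = 1 - η • diagonal hH.isHermitian.eigenvalues := by
      ext i j
      by_cases h : i = j
      · subst h; simp
      · simp [h]
    rw [this, mul_sub, sub_mul, mul_one, hUV, mul_smul_comm, smul_mul_assoc]
    congr 2
  · intro i
    have h1 : hH.isHermitian.eigenvalues i ≤ lam1 := hlam.2 ⟨i, rfl⟩
    have := mul_le_mul_of_nonneg_left h1 hη0.le
    show 0 ≤ 1 - η * hH.isHermitian.eigenvalues i
    linarith
  · intro i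
    have := mul_pos hη0 (hpos i)
    show 1 - η * hH.isHermitian.eigenvalues i < 1
    linarith

/-- For a positive definite `H` with largest eigenvalue `λ₁` and
`0 < η < 1/λ₁`, the map `𝒯̃(A) = H A + A H − η H A H` is a bijection of the set of
symmetric matrices onto itself, its inverse is `A ↦ η ∑_{t=0}^∞ (I−ηH)^t A (I−ηH)^t`
(the series converging), and this inverse is a PSD mapping. -/
theorem Ttilde_inverse_exists_and_psd {d : ℕ} (H : Matrix (Fin d) (Fin d) ℝ)
    (hH : H.PosDef) (lam1 : ℝ)
    (hlam : IsGreatest (Set.range hH.isHermitian.eigenvalues) lam1)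
    (η : ℝ) (hη0 : 0 < η) (hη1 : η < 1 / lam1) :
    (∀ A : Matrix (Fin d) (Fin d) ℝ, A.IsSymm →
      Summable fun t : ℕ => (1 - η • H) ^ t * A * (1 - η • H) ^ t) ∧
    Set.BijOn (fun A : Matrix (Fin d) (Fin d) ℝ => H * A + A * H - η • (H * A * H))
      {A | A.IsSymm} {A | A.IsSymm} ∧
    (∀ A : Matrix (Fin d) (Fin d) ℝ, A.IsSymm →
      (H * (η • ∑' t : ℕ, (1 - η • H) ^ t * A * (1 - η • H) ^ t)
        + (η • ∑' t : ℕ, (1 - η • H) ^ t * A * (1 - η • H) ^ t) * H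
        - η • (H * (η • ∑' t : ℕ, (1 - η • H) ^ t * A * (1 - η • H) ^ t) * H)) = A ∧
      (η • ∑' t : ℕ,
        (1 - η • H) ^ t * (H * A + A * H - η • (H * A * H)) * (1 - η • H) ^ t) = A) ∧
    (∀ A : Matrix (Fin d) (Fin d) ℝ, A.PosSemidef →
      (η • ∑' t : ℕ, (1 - η • H) ^ t * A * (1 - η • H) ^ t).PosSemidef) := by
  have hsum := aux_summable_H H hH lam1 hlam η hη0 hη1
  have hHs : Hᵀ = H := by
    have := hH.isHermitian
    rwa [Matrix.IsHermitian, conjTranspose_eq_transpose_of_trivial] at this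
  have hBs : (1 - η • H)ᵀ = 1 - η • H := by simp [hHs]
  have hexp : ∀ X : Matrix (Fin d) (Fin d) ℝ,
      η • (H * X + X * H - η • (H * X * H)) = X - (1 - η • H) * X * (1 - η • H) := by
    intro X
    simp only [sub_mul, mul_sub, one_mul, mul_one, smul_mul_assoc, mul_smul_comm, smul_sub,
      smul_add, Matrix.mul_assoc]
    abel
  have hstep : ∀ A : Matrix (Fin d) (Fin d) ℝ,
      (∑' t : ℕ, (1 - η • H) ^ t * A * (1 - η • H) ^ t)
        - (1 - η • H) * (∑' t : ℕ, (1 - η • H) ^ t * A * (1 - η • H) ^ t) * (1 - η • H) = A := by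
    intro A
    rw [← (hsum A).tsum_mul_left, ← ((hsum A).mul_left _).tsum_mul_right]
    nth_rewrite 1 [(hsum A).tsum_eq_zero_add]
    have : ∀ t : ℕ, (1 - η • H) ^ (t + 1) * A * (1 - η • H) ^ (t + 1)
        = (1 - η • H) * ((1 - η • H) ^ t * A * (1 - η • H) ^ t) * (1 - η • H) := by
      intro t
      nth_rewrite 1 [pow_succ']
      rw [pow_succ]
      simp only [Matrix.mul_assoc]
    simp only [this]
    simp
  have hright : ∀ A : Matrix (Fin d) (Fin d) ℝ,
      (H * (η • ∑' t : ℕ, (1 - η • H) ^ t * A * (1 - η • H) ^ t)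
        + (η • ∑' t : ℕ, (1 - η • H) ^ t * A * (1 - η • H) ^ t) * H
        - η • (H * (η • ∑' t : ℕ, (1 - η • H) ^ t * A * (1 - η • H) ^ t) * H)) = A := by
    intro A
    have h := hexp (∑' t : ℕ, (1 - η • H) ^ t * A * (1 - η • H) ^ t)
    rw [hstep] at h
    refine Eq.trans ?_ h
    generalize (∑' t : ℕ, (1 - η • H) ^ t * A * (1 - η • H) ^ t) = S
    simp only [smul_mul_assoc, mul_smul_comm, smul_sub, smul_add]
  have hleft : ∀ A : Matrix (Fin d) (Fin d) ℝ, (η • ∑' t : ℕ,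
        (1 - η • H) ^ t * (H * A + A * H - η • (H * A * H)) * (1 - η • H) ^ t) = A := by
    intro A
    rw [← (hsum _).tsum_const_smul]
    refine Eq.trans ?_ (hstep A)
    rw [← (hsum A).tsum_mul_left, ← ((hsum A).mul_left _).tsum_mul_right,
      ← (hsum A).tsum_sub (((hsum A).mul_left _).mul_right _)]
    refine tsum_congr fun t => ?_
    rw [← smul_mul_assoc, ← mul_smul_comm, hexp, mul_sub, sub_mul]
    congr 1
    have h1 : (1 - η • H) ^ t * (1 - η • H) = (1 - η • H) * (1 - η • H) ^ t := by
      rw [← pow_succ, pow_succ']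
    calc _ = ((1 - η • H) ^ t * (1 - η • H)) * A * ((1 - η • H) * (1 - η • H) ^ t) := by
            simp only [Matrix.mul_assoc]
      _ = _ := by
            rw [h1, ← h1]
            nth_rewrite 1 [h1]
            simp only [Matrix.mul_assoc]
  have hsymm : ∀ A : Matrix (Fin d) (Fin d) ℝ, A.IsSymm →
      (η • ∑' t : ℕ, (1 - η • H) ^ t * A * (1 - η • H) ^ t).IsSymm := by
    intro A hA
    rw [Matrix.IsSymm, transpose_smul, transpose_tsum]
    congr 1
    refine tsum_congr fun t => ?_
    rw [transpose_mul, transpose_mul, transpose_pow, hBs, hA.eq, Matrix.mul_assoc]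
  refine ⟨fun A _ => hsum A, ?_, fun A _ => ⟨hright A, hleft A⟩, ?_⟩
  · refine Set.InvOn.bijOn
      (f' := fun A => η • ∑' t : ℕ, (1 - η • H) ^ t * A * (1 - η • H) ^ t)
      ⟨fun A _ => hleft A, fun A _ => hright A⟩ ?_ fun A hA => hsymm A hA
    intro A hA
    have hA' : Aᵀ = A := hA
    show (H * A + A * H - η • (H * A * H))ᵀ = _
    simp only [transpose_sub, transpose_add, transpose_smul, transpose_mul, hHs, hA',
      Matrix.mul_assoc]
    rw [add_comm]
  · intro A hA
    have hAs : A.IsSymm := by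
      have := hA.isHermitian
      rwa [Matrix.IsHermitian, conjTranspose_eq_transpose_of_trivial] at this
    refine PosSemidef.of_dotProduct_mulVec_nonneg ?_ ?_
    · rw [Matrix.IsHermitian, conjTranspose_eq_transpose_of_trivial]
      exact hsymm A hAs
    · intro x
      rw [smul_mulVec, dotProduct_smul, smul_eq_mul]
      refine mul_nonneg hη0.le ?_
      let φ : Matrix (Fin d) (Fin d) ℝ →+ ℝ :=
        { toFun := fun M => star x ⬝ᵥ (M *ᵥ x)
          map_zero' := by simp
          map_add' := fun M N => by rw [add_mulVec, dotProduct_add] }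
      have hφ : Continuous φ := by
        show Continuous fun M : Matrix (Fin d) (Fin d) ℝ => star x ⬝ᵥ (M *ᵥ x)
        fun_prop
      refine ((hsum A).hasSum.map φ hφ).nonneg fun t => ?_
      have hB : ((1 - η • H) ^ t)ᴴ = (1 - η • H) ^ t := by
        rw [conjTranspose_eq_transpose_of_trivial, transpose_pow, hBs]
      have := hA.mul_mul_conjTranspose_same ((1 - η • H) ^ t)
      rw [hB] at this
      exact this.dotProduct_mulVec_nonneg x
end

section
/- Let D₁, …, D_M be distributions of random vectors x ∈ ℝ^d with finite fourth moments, with second-moment matrices H_m := E_{x∼D_m}[x xᵀ], and suppose there is R > 0 with E_{x∼D_m}[‖x‖² x xᵀ] ⪯ R² H_m for every m. Let σ ≥ 0, 0 < η < 1/R², and N ≥ 1. Define the matrix sequence C₀ := 0 and, for m = 1,…,M and t = 0,…,N−1, C_{(m−1)N+t+1} := E_{x∼D_m}[(I − η x xᵀ) C_{(m−1)N+t} (I − η x xᵀ)] + η² σ² H_m. Then C_t ⪯ (η σ² / (1 − η R²)) · I for every t = 0, 1, …, MN. -/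
open MeasureTheory Matrix

lemma vib_memLp {d : ℕ} (μ : Measure (Fin d → ℝ)) [IsProbabilityMeasure μ]
    (hmom : Integrable (fun v => (∑ i, v i ^ 2) ^ 2) μ) (i j : Fin d) :
    MemLp (fun v : Fin d → ℝ => v i * v j) 2 μ := by
  have hm : Measurable (fun v : Fin d → ℝ => v i * v j) :=
    (measurable_pi_apply i).mul (measurable_pi_apply j)
  rw [memLp_two_iff_integrable_sq hm.aestronglyMeasurable]
  refine hmom.mono' (hm.pow_const 2).aestronglyMeasurable (Filter.Eventually.of_forall fun v => ?_)
  have hk : ∀ k, v k ^ 2 ≤ ∑ i, v i ^ 2 := fun k =>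
    Finset.single_le_sum (f := fun i => v i ^ 2) (fun _ _ => sq_nonneg _) (Finset.mem_univ k)
  rw [Real.norm_of_nonneg (sq_nonneg _), mul_pow, sq (∑ i, v i ^ 2)]
  exact mul_le_mul (hk i) (hk j) (sq_nonneg _) ((sq_nonneg _).trans (hk i))

lemma vib_psd {d : ℕ} (μ : Measure (Fin d → ℝ))
    (f : (Fin d → ℝ) → Matrix (Fin d) (Fin d) ℝ)
    (hf : ∀ i j, Integrable (fun v => f v i j) μ)
    (hp : ∀ v, (f v).PosSemidef) : (expMatrix μ f).PosSemidef := by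
  refine Matrix.PosSemidef.of_dotProduct_mulVec_nonneg ?_ fun x => ?_
  · ext i j
    simp only [conjTranspose_apply, expMatrix, of_apply, star_trivial]
    refine integral_congr_ae (Filter.Eventually.of_forall fun v => ?_)
    simpa using (hp v).1.apply i j
  · have h : star x ⬝ᵥ (expMatrix μ f *ᵥ x) = ∫ v, star x ⬝ᵥ (f v *ᵥ x) ∂μ := by
      simp only [dotProduct, mulVec, expMatrix, of_apply]
      rw [integral_finsetSum _ fun i _ =>
        (integrable_finsetSum _ fun j _ => (hf i j).mul_const _).const_mul _]
      refine Finset.sum_congr rfl fun i _ => ?_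
      rw [integral_const_mul, integral_finsetSum _ fun j _ => (hf i j).mul_const _]
      simp only [integral_mul_const]
    rw [h]
    exact integral_nonneg fun v => (hp v).dotProduct_mulVec_nonneg x

lemma vib_vv {d : ℕ} (v : Fin d → ℝ) : vecMulVec v v * vecMulVec v v =
    (∑ k, v k ^ 2) • vecMulVec v v := by
  ext i j
  simp only [mul_apply, vecMulVec_apply, Matrix.smul_apply, smul_eq_mul, Finset.sum_mul]
  exact Finset.sum_congr rfl fun k _ => by ring

lemma vib_int {d : ℕ} (μ : Measure (Fin d → ℝ)) [IsProbabilityMeasure μ]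
    (hmom : Integrable (fun v => (∑ i, v i ^ 2) ^ 2) μ) (η : ℝ)
    (K : Matrix (Fin d) (Fin d) ℝ) (i j : Fin d) :
    Integrable (fun v => ((1 - η • vecMulVec v v) * K * (1 - η • vecMulVec v v)) i j) μ := by
  have hA : ∀ i j : Fin d, MemLp (fun v : Fin d → ℝ =>
      (1 - η • vecMulVec v v : Matrix (Fin d) (Fin d) ℝ) i j) 2 μ := fun i j =>
    (memLp_const _).sub ((vib_memLp μ hmom i j).const_mul η)
  simp only [mul_apply, Finset.sum_mul]
  refine integrable_finsetSum _ fun k _ => integrable_finsetSum _ fun l _ => ?_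
  have := ((hA i l).integrable_mul (hA k j)).const_mul (K l k)
  refine this.congr (Filter.Eventually.of_forall fun v => ?_)
  simp only [Pi.mul_apply]
  ring

lemma vib_step {d : ℕ} (μ : Measure (Fin d → ℝ)) [IsProbabilityMeasure μ]
    (hmom : Integrable (fun v => (∑ i, v i ^ 2) ^ 2) μ) (R σ η c : ℝ) (hη0 : 0 < η) (hc : 0 ≤ c)
    (hce : c * (1 - η * R ^ 2) = η * σ ^ 2)
    (hRH : ((R ^ 2) • (expMatrix μ fun v => vecMulVec v v)
      - expMatrix μ fun v => (∑ k, v k ^ 2) • vecMulVec v v).PosSemidef)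
    (C : Matrix (Fin d) (Fin d) ℝ)
    (hC : (c • (1 : Matrix (Fin d) (Fin d) ℝ) - C).PosSemidef) :
    (c • (1 : Matrix (Fin d) (Fin d) ℝ) - (expMatrix μ (fun v =>
          (1 - η • vecMulVec v v) * C * (1 - η • vecMulVec v v))
        + (η ^ 2 * σ ^ 2) • (expMatrix μ fun v => vecMulVec v v))).PosSemidef := by
  have h2 : ∀ i j, Integrable (fun v : Fin d → ℝ => vecMulVec v v i j) μ := fun i j =>
    (vib_memLp μ hmom i j).integrable (by norm_num)
  have h4 : ∀ i j, Integrable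
      (fun v : Fin d → ℝ => ((∑ k, v k ^ 2) • vecMulVec v v) i j) μ := fun i j => by
    simp only [← vib_vv, mul_apply]
    exact integrable_finsetSum _ fun k _ =>
      (vib_memLp μ hmom i k).integrable_mul (vib_memLp μ hmom k j)
  have hP1 := vib_psd μ (fun v => (1 - η • vecMulVec v v) * (c • 1 - C) * (1 - η • vecMulVec v v))
    (vib_int μ hmom η _) (fun v => by
      have h := hC.mul_mul_conjTranspose_same (1 - η • vecMulVec v v)
      have e : (1 - η • vecMulVec v v : Matrix (Fin d) (Fin d) ℝ)ᴴ = 1 - η • vecMulVec v v := by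
        ext i j
        simp [vecMulVec_apply, one_apply, eq_comm, mul_comm]
      rwa [e] at h)
  have hP2 := vib_psd μ (fun v => vecMulVec v v) h2 (fun v => by
      simpa using posSemidef_vecMulVec_self_star v)
  have key := (hP1.add (hP2.smul (mul_nonneg hc hη0.le))).add
    (hRH.smul (mul_nonneg hc (sq_nonneg η)))
  convert key using 1
  have hP : (expMatrix μ fun v => (1 - η • vecMulVec v v) * (c • 1 - C) * (1 - η • vecMulVec v v))
      = c • 1 - (2 * c * η) • (expMatrix μ fun v => vecMulVec v v)
        + (c * η ^ 2) • (expMatrix μ fun v => (∑ k, v k ^ 2) • vecMulVec v v)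
        - expMatrix μ (fun v => (1 - η • vecMulVec v v) * C * (1 - η • vecMulVec v v)) := by
    ext i j
    rw [Matrix.sub_apply, Matrix.add_apply, Matrix.sub_apply, Matrix.smul_apply, Matrix.smul_apply,
      Matrix.smul_apply]
    simp only [expMatrix, of_apply, smul_eq_mul]
    have e : ∀ v : Fin d → ℝ,
        ((1 - η • vecMulVec v v) * (c • 1 - C) * (1 - η • vecMulVec v v)) i j =
        c * (1 : Matrix (Fin d) (Fin d) ℝ) i j - (2 * c * η) * vecMulVec v v i j
          + (c * η ^ 2) * ((∑ k, v k ^ 2) • vecMulVec v v) i j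
          - ((1 - η • vecMulVec v v) * C * (1 - η • vecMulVec v v)) i j := fun v => by
      have : (1 - η • vecMulVec v v) * (c • 1 - C) * (1 - η • vecMulVec v v) =
        c • (1 : Matrix (Fin d) (Fin d) ℝ) - (2 * c * η) • vecMulVec v v
          + (c * η ^ 2) • ((∑ k, v k ^ 2) • vecMulVec v v)
          - ((1 - η • vecMulVec v v) * C * (1 - η • vecMulVec v v)) := by
        rw [← vib_vv]
        simp only [mul_sub, sub_mul, mul_smul_comm, smul_mul_assoc, mul_one, one_mul]
        module
      rw [this]; rfl
    simp only [e]
    have i1 : Integrable (fun _ : Fin d → ℝ => c * (1 : Matrix (Fin d) (Fin d) ℝ) i j) μ :=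
      integrable_const _
    have i2 := (h2 i j).const_mul (2 * c * η)
    have i3 := (h4 i j).const_mul (c * η ^ 2)
    have i12 : Integrable (fun v : Fin d → ℝ => c * (1 : Matrix (Fin d) (Fin d) ℝ) i j
        - (2 * c * η) * vecMulVec v v i j) μ := i1.sub i2
    have i123 : Integrable (fun v : Fin d → ℝ => c * (1 : Matrix (Fin d) (Fin d) ℝ) i j
        - (2 * c * η) * vecMulVec v v i j
        + (c * η ^ 2) * ((∑ k, v k ^ 2) • vecMulVec v v) i j) μ := i12.add i3
    have i4 := vib_int μ hmom η C i j
    rw [integral_sub i123 i4, integral_add i12 i3, integral_sub i1 i2,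
      integral_const_mul, integral_const_mul]
    simp [integral_const_mul]
  rw [hP]
  have : η ^ 2 * σ ^ 2 = η * (c * (1 - η * R ^ 2)) := by rw [hce]; ring
  rw [this]
  module

/-- For the variance-iterate recursion of continual SGD over `M` tasks
(tasks indexed by `m : Fin M`, so that `m.val` plays the role of `m − 1`), with
`E_{x∼D_m}[‖x‖² x xᵀ] ⪯ R² H_m` and `0 < η < 1/R²`,
one has `C_t ⪯ (η σ²/(1 − η R²)) · I` for every `t = 0, 1, …, MN`. -/
theorem variance_iterates_bounded {d M N : ℕ} (hN : 1 ≤ N)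
    (D : Fin M → Measure (Fin d → ℝ)) [∀ m, IsProbabilityMeasure (D m)]
    (hmom : ∀ m, Integrable (fun v => (∑ i, v i ^ 2) ^ 2) (D m))
    (H : Fin M → Matrix (Fin d) (Fin d) ℝ)
    (hH : ∀ m, H m = expMatrix (D m) fun v => vecMulVec v v)
    (R : ℝ) (hR : 0 < R)
    (hRH : ∀ m,
      ((R ^ 2) • H m - expMatrix (D m) fun v => (∑ k, v k ^ 2) • vecMulVec v v).PosSemidef)
    (σ η : ℝ) (hσ : 0 ≤ σ) (hη0 : 0 < η) (hη1 : η < 1 / R ^ 2)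
    (C : ℕ → Matrix (Fin d) (Fin d) ℝ) (hC0 : C 0 = 0)
    (hCrec : ∀ m : Fin M, ∀ t < N,
      C (m.val * N + t + 1) =
        expMatrix (D m) (fun v =>
          (1 - η • vecMulVec v v) * C (m.val * N + t) * (1 - η • vecMulVec v v))
        + (η ^ 2 * σ ^ 2) • H m) :
    ∀ t ≤ M * N,
      ((η * σ ^ 2 / (1 - η * R ^ 2)) • (1 : Matrix (Fin d) (Fin d) ℝ) - C t).PosSemidef := by
  have hR2 : 0 < R ^ 2 := by positivity
  have hpos : 0 < 1 - η * R ^ 2 := by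
    rw [lt_div_iff₀ hR2] at hη1
    linarith
  have hc : 0 ≤ η * σ ^ 2 / (1 - η * R ^ 2) := by positivity
  intro t
  induction t with
  | zero =>
    intro _
    rw [hC0, sub_zero]
    exact Matrix.PosSemidef.one.smul hc
  | succ t ih =>
    intro ht
    have hN' : 0 < N := hN
    have hm : t / N < M := (Nat.div_lt_iff_lt_mul hN').2 ht
    have h := hCrec ⟨t / N, hm⟩ (t % N) (Nat.mod_lt _ hN')
    have e : t / N * N + t % N = t := Nat.div_add_mod' t N
    simp only [e] at h
    rw [h, hH]
    refine vib_step _ (hmom _) R σ η _ hη0 hc (div_mul_cancel₀ _ hpos.ne') ?_ _ (ih (by omega))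
    rw [← hH]
    exact hRH _
end

section
/- Let H be a positive semidefinite d×d real matrix and η > 0 with η · λ_max(H) ≤ 1, where λ_max(H) is the largest eigenvalue of H. Then for every integer N ≥ 1: (1/2) · (I − (I − ηH)^{2N}) ⪯ Σ_{t=0}^{N−1} η (I − ηH)^{2t} H ⪯ I − (I − ηH)^N. -/
open Matrix

theorem aeval_posSemidef_of_eigen {d : ℕ} (H : Matrix (Fin d) (Fin d) ℝ) (hH : H.IsHermitian)
    (p : Polynomial ℝ) (hp : ∀ i, 0 ≤ p.eval (hH.eigenvalues i)) :
    (Polynomial.aeval H p).PosSemidef := by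
  have h1 : Polynomial.aeval (diagonal hH.eigenvalues) p
      = diagonal (fun i => p.eval (hH.eigenvalues i)) := by
    have := Polynomial.aeval_algHom_apply (Matrix.diagonalAlgHom (n := Fin d) (α := ℝ) ℝ)
      hH.eigenvalues p
    simp only [Matrix.diagonalAlgHom_apply] at this
    rw [this]
    congr 1
    funext i
    have := Polynomial.aeval_algHom_apply (Pi.evalAlgHom ℝ (fun _ : Fin d => ℝ) i)
      hH.eigenvalues p
    simpa using this.symm
  have h2 : Polynomial.aeval H p = (hH.eigenvectorUnitary : Matrix (Fin d) (Fin d) ℝ) *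
      diagonal (fun i => p.eval (hH.eigenvalues i)) *
      (hH.eigenvectorUnitary : Matrix (Fin d) (Fin d) ℝ)ᴴ := by
    have h3 := Polynomial.aeval_algHom_apply
      ((Unitary.conjStarAlgAut ℝ (Matrix (Fin d) (Fin d) ℝ) hH.eigenvectorUnitary).toAlgEquiv.toAlgHom)
      (diagonal hH.eigenvalues) p
    rw [h1] at h3
    have h4 := hH.spectral_theorem
    conv_lhs => rw [h4]
    exact h3
  rw [h2]
  exact (PosSemidef.diagonal (fun i => hp i)).mul_mul_conjTranspose_same _

theorem scalar_sandwich (a : ℝ) (h0 : 0 ≤ a) (h1 : a ≤ 1) (N : ℕ) :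
    0 ≤ (∑ t ∈ Finset.range N, (1 - a) ^ (2 * t) * a) - 2⁻¹ * (1 - (1 - a) ^ (2 * N)) ∧
    0 ≤ (1 - (1 - a) ^ N) - ∑ t ∈ Finset.range N, (1 - a) ^ (2 * t) * a := by
  have hx : 0 ≤ 1 - a := by linarith
  induction N with
  | zero => simp
  | succ n ih =>
    rw [Finset.sum_range_succ]
    have e : (1 - a) ^ (2 * (n + 1)) = (1 - a) ^ (2 * n) * (1 - a) ^ 2 := by ring
    have e' : (1 - a) ^ (2 * n) ≤ (1 - a) ^ n :=
      pow_le_pow_of_le_one hx (by linarith) (by omega)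
    have hp : 0 ≤ (1 - a) ^ (2 * n) := by positivity
    constructor
    · rw [e]
      nlinarith [ih.1, mul_nonneg hp (mul_nonneg h0 h0)]
    · rw [pow_succ]
      nlinarith [ih.2, mul_le_mul_of_nonneg_right e' h0]

/-- For PSD `H` and `η > 0` with `η · λ_max(H) ≤ 1`, for every `N ≥ 1`:
`(1/2)(I − (I−ηH)^{2N}) ⪯ ∑_{t=0}^{N−1} η (I−ηH)^{2t} H ⪯ I − (I−ηH)^N`. -/
theorem geometric_sum_sandwich {d : ℕ} (H : Matrix (Fin d) (Fin d) ℝ)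
    (hH : H.PosSemidef) (η : ℝ) (hη : 0 < η) (lamMax : ℝ)
    (hlam : IsGreatest (Set.range hH.isHermitian.eigenvalues) lamMax)
    (heta_lam : η * lamMax ≤ 1) (N : ℕ) (hN : 1 ≤ N) :
    ((∑ t ∈ Finset.range N, η • ((1 - η • H) ^ (2 * t) * H))
      - (2⁻¹ : ℝ) • (1 - (1 - η • H) ^ (2 * N))).PosSemidef ∧
    ((1 - (1 - η • H) ^ N)
      - ∑ t ∈ Finset.range N, η • ((1 - η • H) ^ (2 * t) * H)).PosSemidef := by
  have key : ∀ i, _ := fun i => scalar_sandwich (η * hH.isHermitian.eigenvalues i)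
    (mul_nonneg hη.le (hH.eigenvalues_nonneg i))
    ((mul_le_mul_of_nonneg_left (hlam.2 ⟨i, rfl⟩) hη.le).trans heta_lam) N
  have hs : ∀ x : ℝ, ∑ t ∈ Finset.range N, (1 - η * x) ^ (2 * t) * (η * x)
      = ∑ t ∈ Finset.range N, η * ((1 - η * x) ^ (2 * t) * x) :=
    fun x => Finset.sum_congr rfl fun t _ => by ring
  constructor
  · have := aeval_posSemidef_of_eigen H hH.isHermitian
      ((∑ t ∈ Finset.range N, η • ((1 - η • Polynomial.X) ^ (2 * t) * Polynomial.X))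
      - (2⁻¹ : ℝ) • (1 - (1 - η • Polynomial.X) ^ (2 * N))) (fun i => by
        have := (key i).1
        rw [hs] at this
        simpa [Polynomial.eval_finset_sum] using this)
    simpa only [map_sub, map_sum, map_smul, map_mul, map_pow, map_one, Polynomial.aeval_X] using this
  · have := aeval_posSemidef_of_eigen H hH.isHermitian
      ((1 - (1 - η • Polynomial.X) ^ N)
      - (∑ t ∈ Finset.range N, η • ((1 - η • Polynomial.X) ^ (2 * t) * Polynomial.X))) (fun i => by
        have := (key i).2
        rw [hs] at this
        simpa [Polynomial.eval_finset_sum] using this)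
    simpa only [map_sub, map_sum, map_smul, map_mul, map_pow, map_one, Polynomial.aeval_X] using this
end

section
/- Let x be a random vector in ℝ^d with E‖x‖⁴ < ∞ and H := E[x xᵀ], and suppose there is α > 0 such that E[x xᵀ A x xᵀ] ⪯ α · tr(H A) · H for every positive semidefinite A. Let 0 < η < 1/(α · tr(H)), and define the linear map Q on symmetric matrices by Q(A) := E[(I − η x xᵀ) A (I − η x xᵀ)]. Then for every integer N ≥ 1: (1/(2η)) · (I − (I − ηH)^{2N}) ⪯ Σ_{t=0}^{N−1} Q^t(H) ⪯ (1/η) · (I − (I − ηH)^{2N}). -/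
open MeasureTheory Matrix

section Helpers

/-- Entrywise integrability of a matrix-valued random variable. -/
def EntInt {Ω : Type*} [MeasurableSpace Ω] {d : ℕ}
    (μ : Measure Ω) (f : Ω → Matrix (Fin d) (Fin d) ℝ) : Prop :=
  ∀ i j, Integrable (fun ω => f ω i j) μ

variable {Ω : Type*} [MeasurableSpace Ω] {d : ℕ} {μ : Measure Ω}
  {f g : Ω → Matrix (Fin d) (Fin d) ℝ}

lemma EntInt.add (hf : EntInt μ f) (hg : EntInt μ g) : EntInt μ (fun ω => f ω + g ω) :=
  fun i j => (hf i j).add (hg i j)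

lemma EntInt.sub (hf : EntInt μ f) (hg : EntInt μ g) : EntInt μ (fun ω => f ω - g ω) :=
  fun i j => (hf i j).sub (hg i j)

lemma EntInt.smul (c : ℝ) (hf : EntInt μ f) : EntInt μ (fun ω => c • f ω) :=
  fun i j => (hf i j).const_mul c

lemma EntInt.const [IsProbabilityMeasure μ] (A : Matrix (Fin d) (Fin d) ℝ) :
    EntInt μ (fun _ => A) :=
  fun _ _ => integrable_const _

lemma EntInt.mul_left (A : Matrix (Fin d) (Fin d) ℝ) (hf : EntInt μ f) :
    EntInt μ (fun ω => A * f ω) := fun i j => by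
  simp only [Matrix.mul_apply]
  exact integrable_finsetSum _ fun k _ => (hf k j).const_mul _

lemma EntInt.mul_right (A : Matrix (Fin d) (Fin d) ℝ) (hf : EntInt μ f) :
    EntInt μ (fun ω => f ω * A) := fun i j => by
  simp only [Matrix.mul_apply]
  exact integrable_finsetSum _ fun k _ => (hf i k).mul_const _

lemma expMatrix_add' (hf : EntInt μ f) (hg : EntInt μ g) :
    expMatrix μ (fun ω => f ω + g ω) = expMatrix μ f + expMatrix μ g := by
  ext i j
  exact integral_add (hf i j) (hg i j)

lemma expMatrix_sub' (hf : EntInt μ f) (hg : EntInt μ g) :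
    expMatrix μ (fun ω => f ω - g ω) = expMatrix μ f - expMatrix μ g := by
  ext i j
  exact integral_sub (hf i j) (hg i j)

lemma expMatrix_smul' (c : ℝ) (f : Ω → Matrix (Fin d) (Fin d) ℝ) :
    expMatrix μ (fun ω => c • f ω) = c • expMatrix μ f := by
  ext i j
  exact integral_const_mul c _

lemma expMatrix_const' [IsProbabilityMeasure μ] (A : Matrix (Fin d) (Fin d) ℝ) :
    expMatrix μ (fun _ => A) = A := by
  ext i j
  simp [expMatrix]

lemma expMatrix_mul_left' (A : Matrix (Fin d) (Fin d) ℝ) (hf : EntInt μ f) :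
    expMatrix μ (fun ω => A * f ω) = A * expMatrix μ f := by
  ext i j
  simp only [expMatrix, Matrix.of_apply, Matrix.mul_apply]
  rw [integral_finsetSum _ fun k _ => (hf k j).const_mul _]
  simp only [integral_const_mul]

lemma expMatrix_mul_right' (A : Matrix (Fin d) (Fin d) ℝ) (hf : EntInt μ f) :
    expMatrix μ (fun ω => f ω * A) = expMatrix μ f * A := by
  ext i j
  simp only [expMatrix, Matrix.of_apply, Matrix.mul_apply]
  rw [integral_finsetSum _ fun k _ => (hf i k).mul_const _]
  simp only [integral_mul_const]

lemma expMatrix_psd (hf : EntInt μ f) (h : ∀ ω, (f ω).PosSemidef) :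
    (expMatrix μ f).PosSemidef := by
  refine Matrix.PosSemidef.of_dotProduct_mulVec_nonneg ?_ ?_
  · ext i j
    simp only [expMatrix, Matrix.conjTranspose_apply, Matrix.of_apply, star_trivial]
    congr 1
    ext ω
    simpa using (h ω).1.apply i j
  · intro v
    have e : star v ⬝ᵥ expMatrix μ f *ᵥ v = ∫ ω, star v ⬝ᵥ f ω *ᵥ v ∂μ := by
      simp only [dotProduct, mulVec, expMatrix, Matrix.of_apply]
      rw [integral_finsetSum]
      · refine Finset.sum_congr rfl fun i _ => ?_
        rw [integral_const_mul, integral_finsetSum _ fun k _ => (hf i k).mul_const _]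
        simp only [integral_mul_const]
      · intro i _
        exact (integrable_finsetSum _ fun k _ => (hf i k).mul_const _).const_mul _
    rw [e]
    exact integral_nonneg fun ω => (h ω).dotProduct_mulVec_nonneg v

lemma psd_conj {A B : Matrix (Fin d) (Fin d) ℝ} (hA : A.PosSemidef) (hB : Bᵀ = B) :
    (B * A * B).PosSemidef := by
  have := hA.mul_mul_conjTranspose_same B
  rwa [Matrix.conjTranspose_eq_transpose_of_trivial, hB] at this

/-- Jensen-type inequality. -/
lemma expMatrix_conj_psd [IsProbabilityMeasure μ] (W : Ω → Matrix (Fin d) (Fin d) ℝ)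
    (hW : EntInt μ W) (hsymm : ∀ ω, (W ω)ᵀ = W ω)
    (A : Matrix (Fin d) (Fin d) ℝ) (hWAW : EntInt μ fun ω => W ω * A * W ω)
    (hA : A.PosSemidef) :
    (expMatrix μ (fun ω => W ω * A * W ω) - expMatrix μ W * A * expMatrix μ W).PosSemidef := by
  set V := expMatrix μ W with hV
  have hVs : Vᵀ = V := by
    ext i j
    simp only [hV, expMatrix, Matrix.transpose_apply, Matrix.of_apply]
    congr 1
    ext ω
    conv_lhs => rw [← hsymm ω]
    rfl
  have i1 : EntInt μ (fun ω => V * A * W ω) := hW.mul_left _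
  have i2 : EntInt μ (fun ω => W ω * (A * V)) := hW.mul_right _
  have i3 : EntInt μ (fun _ : Ω => V * A * V) := EntInt.const _
  have hi := ((hWAW.sub i1).sub i2).add i3
  have key : ∀ ω, W ω * A * W ω - V * A * W ω - W ω * (A * V) + V * A * V
      = (W ω - V) * A * (W ω - V) := fun ω => by noncomm_ring
  have h := expMatrix_psd hi fun ω => by
    rw [key]
    exact psd_conj hA (by rw [Matrix.transpose_sub, hsymm, hVs])
  rw [expMatrix_add' ((hWAW.sub i1).sub i2) i3, expMatrix_sub' (hWAW.sub i1) i2,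
    expMatrix_sub' hWAW i1, expMatrix_mul_left' _ hW, expMatrix_mul_right' _ hW,
    expMatrix_const', ← hV] at h
  convert h using 1
  noncomm_ring

/-- The deterministic part of the argument. -/
lemma sandwich_core (L : Matrix (Fin d) (Fin d) ℝ →ₗ[ℝ] Matrix (Fin d) (Fin d) ℝ)
    (H : Matrix (Fin d) (Fin d) ℝ) (hH : H.PosSemidef) (η : ℝ) (hη : 0 < η)
    (hpos : ∀ A : Matrix (Fin d) (Fin d) ℝ, A.PosSemidef → (L A).PosSemidef)
    (hlow : ∀ A : Matrix (Fin d) (Fin d) ℝ, A.PosSemidef →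
      (L A - (1 - η • H) * A * (1 - η • H)).PosSemidef)
    (hone : (1 - η • H - L 1).PosSemidef) (N : ℕ) :
    ((∑ t ∈ Finset.range N, L^[t] H)
      - (2 * η)⁻¹ • (1 - (1 - η • H) ^ (2 * N))).PosSemidef ∧
    (η⁻¹ • (1 - (1 - η • H) ^ (2 * N))
      - ∑ t ∈ Finset.range N, L^[t] H).PosSemidef := by
  set V : Matrix (Fin d) (Fin d) ℝ := 1 - η • H with hV
  have hHs : Hᵀ = H := by
    have := hH.1
    rwa [Matrix.IsHermitian, Matrix.conjTranspose_eq_transpose_of_trivial] at this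
  have hVs : Vᵀ = V := by simp [hV, hHs]
  have hVts : ∀ t, (V ^ t)ᵀ = V ^ t := fun t => by rw [Matrix.transpose_pow, hVs]
  have hposN : ∀ t (A : Matrix (Fin d) (Fin d) ℝ), A.PosSemidef → (L^[t] A).PosSemidef := by
    intro t
    induction t with
    | zero => intro A hA; simpa using hA
    | succ t ih => intro A hA; rw [Function.iterate_succ_apply']; exact hpos _ (ih A hA)
  have hlowN : ∀ (A : Matrix (Fin d) (Fin d) ℝ), A.PosSemidef → ∀ t,
      (L^[t] A - V ^ t * A * V ^ t).PosSemidef := by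
    intro A hA t
    induction t with
    | zero => simpa using Matrix.PosSemidef.zero
    | succ t ih =>
      rw [Function.iterate_succ_apply']
      have h1 := hpos _ ih
      have h2 := hlow _ (psd_conj hA (hVts t))
      have h3 := h1.add h2
      rw [map_sub] at h3
      convert h3 using 1
      rw [sub_add_sub_cancel, pow_succ' V t]
      congr 1
      rw [← pow_succ', pow_succ' V t, ← pow_succ']
      nth_rewrite 2 [pow_succ]
      rw [pow_succ']
      simp only [Matrix.mul_assoc]
  have hcomm : Commute H V := by
    rw [hV]
    exact (Commute.one_right H).sub_right ((Commute.refl H).smul_right η)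
  constructor
  · -- telescoping of the lower bound
    induction N with
    | zero => simpa using Matrix.PosSemidef.zero
    | succ N ih =>
      have hB : (H * V ^ N)ᵀ = H * V ^ N := by
        rw [Matrix.transpose_mul, hVts, hHs, (hcomm.pow_right N).eq]
      have h1 : ((η / 2) • ((H * V ^ N) * 1 * (H * V ^ N))).PosSemidef :=
        (psd_conj Matrix.PosSemidef.one hB).smul (by positivity)
      have h2 := (ih.add (hlowN H hH N)).add h1
      rw [Finset.sum_range_succ]
      convert h2 using 1
      have e1 : V ^ N * H * V ^ N = H * V ^ (2 * N) := by
        rw [← (hcomm.pow_right N).eq, mul_assoc, ← pow_add, two_mul]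
      have e2 : (H * V ^ N) * 1 * (H * V ^ N) = H * H * V ^ (2 * N) := by
        rw [mul_one, mul_assoc, ← mul_assoc (V ^ N), e1, mul_assoc]
      have e3 : V ^ (2 * (N + 1)) = V ^ (2 * N) - (2 * η) • (H * V ^ (2 * N))
          + (η ^ 2) • (H * H * V ^ (2 * N)) := by
        rw [mul_add, mul_one, add_comm, pow_add]
        have : V ^ 2 = 1 - (2 * η) • H + (η ^ 2) • (H * H) := by
          simp only [hV, pow_two, sub_mul, mul_sub, one_mul, mul_one, Matrix.smul_mul,
            Matrix.mul_smul, smul_smul]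
          module
        rw [this, add_mul, sub_mul, one_mul, Matrix.smul_mul, Matrix.smul_mul]
      rw [e1, e2, e3]
      have hne : η ≠ 0 := hη.ne'
      match_scalars <;> field_simp <;> ring
  · have hup : (η⁻¹ • (1 - L^[N] 1) - ∑ t ∈ Finset.range N, L^[t] H).PosSemidef := by
      clear hlowN
      induction N with
      | zero => simpa using Matrix.PosSemidef.zero
      | succ N ih =>
        have h0 := hposN N _ (hone.smul (inv_nonneg.2 hη.le))
        have e : L^[N] (η⁻¹ • (V - L 1)) = η⁻¹ • (L^[N] 1 - L^[N + 1] 1) - L^[N] H := by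
          have : η⁻¹ • (V - L 1) = η⁻¹ • (1 - L 1) - H := by
            have hne : η ≠ 0 := hη.ne'
            rw [hV]
            match_scalars <;> field_simp
          rw [this, Function.iterate_succ_apply, ← Module.End.pow_apply, map_sub, map_smul,
            map_sub]
          simp only [Module.End.pow_apply]
        rw [e] at h0
        have h2 := ih.add h0
        rw [Finset.sum_range_succ]
        convert h2 using 1
        module
    have h1 := (hlowN 1 Matrix.PosSemidef.one N).smul (inv_nonneg.2 hη.le)
    have h2 := hup.add h1
    convert h2 using 1
    rw [mul_one, ← pow_add, ← two_mul]
    module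

end Helpers

/-- Under the fourth-moment upper condition with constant `α` and
`0 < η < 1/(α tr H)`, with `Q(A) := E[(I − η x xᵀ) A (I − η x xᵀ)]`, for every `N ≥ 1`:
`(1/(2η))(I − (I−ηH)^{2N}) ⪯ ∑_{t=0}^{N−1} Q^t(H) ⪯ (1/η)(I − (I−ηH)^{2N})`. -/
theorem sum_Q_iterates_sandwich {d : ℕ} {Ω : Type*} [MeasurableSpace Ω]
    (μ : Measure Ω) [IsProbabilityMeasure μ]
    (x : Ω → Fin d → ℝ) (hmeas : Measurable x)
    (hx4 : Integrable (fun ω => (∑ i, x ω i ^ 2) ^ 2) μ)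
    (H : Matrix (Fin d) (Fin d) ℝ)
    (hH : H = expMatrix μ fun ω => vecMulVec (x ω) (x ω))
    (α : ℝ) (hα : 0 < α)
    (hup : ∀ A : Matrix (Fin d) (Fin d) ℝ, A.PosSemidef →
      ((α * (H * A).trace) • H
        - expMatrix μ fun ω => (x ω ⬝ᵥ A *ᵥ x ω) • vecMulVec (x ω) (x ω)).PosSemidef)
    (η : ℝ) (hη0 : 0 < η) (hη1 : η < 1 / (α * H.trace))
    (Q : Matrix (Fin d) (Fin d) ℝ → Matrix (Fin d) (Fin d) ℝ)
    (hQ : ∀ A, Q A = expMatrix μ fun ω =>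
      (1 - η • vecMulVec (x ω) (x ω)) * A * (1 - η • vecMulVec (x ω) (x ω)))
    (N : ℕ) (hN : 1 ≤ N) :
    ((∑ t ∈ Finset.range N, Q^[t] H)
      - (2 * η)⁻¹ • (1 - (1 - η • H) ^ (2 * N))).PosSemidef ∧
    (η⁻¹ • (1 - (1 - η • H) ^ (2 * N))
      - ∑ t ∈ Finset.range N, Q^[t] H).PosSemidef := by
  have hm : ∀ i, Measurable fun ω => x ω i := fun i => (measurable_pi_apply i).comp hmeas
  have hsq : ∀ ω i, x ω i ^ 2 ≤ ∑ i, x ω i ^ 2 := fun ω i =>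
    Finset.single_le_sum (f := fun i => x ω i ^ 2) (fun _ _ => sq_nonneg _) (Finset.mem_univ i)
  have hprod : ∀ ω i j, |x ω i * x ω j| ≤ ∑ i, x ω i ^ 2 := fun ω i j => by
    rw [abs_le]
    constructor <;>
      nlinarith [hsq ω i, hsq ω j, sq_nonneg (x ω i + x ω j), sq_nonneg (x ω i - x ω j)]
  have i4 : ∀ i j k l, Integrable (fun ω => x ω i * x ω j * (x ω k * x ω l)) μ := by
    intro i j k l
    refine hx4.mono' (((hm i).mul (hm j)).mul ((hm k).mul (hm l))).aestronglyMeasurable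
      (Filter.Eventually.of_forall fun ω => ?_)
    rw [Real.norm_eq_abs, abs_mul, pow_two]
    exact mul_le_mul (hprod ω i j) (hprod ω k l) (abs_nonneg _)
      ((abs_nonneg _).trans (hprod ω i j))
  have iX : EntInt μ fun ω => vecMulVec (x ω) (x ω) := by
    intro i j
    refine (hx4.add (integrable_const (1 : ℝ))).mono'
      ((hm i).mul (hm j)).aestronglyMeasurable (Filter.Eventually.of_forall fun ω => ?_)
    simp only [vecMulVec_apply, Real.norm_eq_abs, Pi.add_apply]
    nlinarith [hprod ω i j, sq_nonneg ((∑ i, x ω i ^ 2) - 1)]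
  have iM : ∀ A : Matrix (Fin d) (Fin d) ℝ,
      EntInt μ fun ω => (x ω ⬝ᵥ A *ᵥ x ω) • vecMulVec (x ω) (x ω) := by
    intro A i j
    simp only [Matrix.smul_apply, vecMulVec_apply, smul_eq_mul, dotProduct, mulVec,
      Finset.mul_sum, Finset.sum_mul]
    refine integrable_finsetSum _ fun k _ => integrable_finsetSum _ fun l _ => ?_
    refine ((i4 k l i j).const_mul (A k l)).congr (Filter.Eventually.of_forall fun ω => ?_)
    simp only
    ring
  have hXAX : ∀ (A : Matrix (Fin d) (Fin d) ℝ) ω,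
      vecMulVec (x ω) (x ω) * A * vecMulVec (x ω) (x ω)
        = (x ω ⬝ᵥ A *ᵥ x ω) • vecMulVec (x ω) (x ω) := by
    intro A ω
    rw [Matrix.vecMulVec_mul, Matrix.vecMulVec_mul_vecMulVec, Matrix.dotProduct_mulVec,
      Matrix.vecMulVec_smul]
  have hexp : ∀ (A : Matrix (Fin d) (Fin d) ℝ) ω,
      (1 - η • vecMulVec (x ω) (x ω)) * A * (1 - η • vecMulVec (x ω) (x ω))
        = A - η • (vecMulVec (x ω) (x ω) * A) - η • (A * vecMulVec (x ω) (x ω))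
          + η ^ 2 • ((x ω ⬝ᵥ A *ᵥ x ω) • vecMulVec (x ω) (x ω)) := by
    intro A ω
    rw [← hXAX]
    simp only [sub_mul, mul_sub, one_mul, mul_one, Matrix.smul_mul, Matrix.mul_smul]
    module
  have iQ : ∀ A : Matrix (Fin d) (Fin d) ℝ, EntInt μ fun ω =>
      (1 - η • vecMulVec (x ω) (x ω)) * A * (1 - η • vecMulVec (x ω) (x ω)) := by
    intro A
    simp only [hexp]
    exact (((EntInt.const A).sub ((iX.mul_right A).smul η)).sub
      ((iX.mul_left A).smul η)).add ((iM A).smul _)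
  have iW : EntInt μ fun ω => 1 - η • vecMulVec (x ω) (x ω) := (EntInt.const 1).sub (iX.smul η)
  have eW : expMatrix μ (fun ω => 1 - η • vecMulVec (x ω) (x ω)) = 1 - η • H := by
    rw [expMatrix_sub' (EntInt.const 1) (iX.smul η), expMatrix_const', expMatrix_smul', ← hH]
  have hWs : ∀ ω, (1 - η • vecMulVec (x ω) (x ω))ᵀ = 1 - η • vecMulVec (x ω) (x ω) := by
    intro ω
    simp [Matrix.transpose_vecMulVec]
  have hHp : H.PosSemidef := by
    rw [hH]
    refine expMatrix_psd iX fun ω => ?_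
    have := Matrix.posSemidef_vecMulVec_self_star (x ω)
    rwa [star_trivial] at this
  let L : Matrix (Fin d) (Fin d) ℝ →ₗ[ℝ] Matrix (Fin d) (Fin d) ℝ :=
    { toFun := Q
      map_add' := fun A B => by
        simp only [hQ]
        rw [← expMatrix_add' (iQ A) (iQ B)]
        simp only [mul_add, add_mul]
      map_smul' := fun c A => by
        simp only [hQ, RingHom.id_apply]
        rw [← expMatrix_smul']
        simp only [Matrix.mul_smul, Matrix.smul_mul] }
  have hpos : 0 < α * H.trace := by
    have := hη0.trans hη1
    exact one_div_pos.1 this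
  have hηα : η * (α * H.trace) < 1 := (lt_div_iff₀ hpos).1 hη1
  refine sandwich_core L H hHp η hη0 ?_ ?_ ?_ N
  · intro A hA
    change (Q A).PosSemidef
    rw [hQ]
    exact expMatrix_psd (iQ A) fun ω => psd_conj hA (hWs ω)
  · intro A hA
    change (Q A - _).PosSemidef
    rw [hQ, ← eW]
    exact expMatrix_conj_psd _ iW hWs A (iQ A) hA
  · change (1 - η • H - Q 1).PosSemidef
    have e1 : Q 1 = 1 - η • H - η • H
        + η ^ 2 • expMatrix μ fun ω => (x ω ⬝ᵥ (1 : Matrix (Fin d) (Fin d) ℝ) *ᵥ x ω) •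
          vecMulVec (x ω) (x ω) := by
      rw [hQ]
      simp only [hexp 1]
      simp only [mul_one, one_mul (vecMulVec _ _)]
      rw [expMatrix_add' (((EntInt.const 1).sub (iX.smul η)).sub (iX.smul η)) ((iM 1).smul _),
        expMatrix_sub' ((EntInt.const 1).sub (iX.smul η)) (iX.smul η), eW, expMatrix_smul',
        expMatrix_smul', ← hH]
    have h1 := (hup 1 Matrix.PosSemidef.one).smul (sq_nonneg η)
    have h2 : ((η * (1 - η * (α * H.trace))) • H).PosSemidef :=
      hHp.smul (mul_nonneg hη0.le (by linarith))
    have h3 := h1.add h2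
    rw [mul_one] at h3
    rw [e1]
    convert h3 using 1
    module
end

section
/- Let x be a random vector in ℝ^d with E‖x‖⁴ < ∞ and H := E[x xᵀ], and suppose there is α > 0 such that E[x xᵀ A x xᵀ] ⪯ α · tr(H A) · H for every positive semidefinite A. Let 0 < η < 1/(α · tr(H)), fix an integer N ≥ 1 and a positive semidefinite matrix B₀, and set B_{0,N} := B₀ − (I − ηH)^N B₀ (I − ηH)^N. Define Q(A) := E[(I − η x xᵀ) A (I − η x xᵀ)] on symmetric matrices and S_t := Σ_{k=0}^{t−1} Q^k(B₀). Then for every t ≤ N: S_t ⪯ Σ_{k=0}^{t−1} (I − ηH)^k [ (η α tr(B_{0,N}) / (1 − η α tr(H))) · H + B₀ ] (I − ηH)^k. -/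
open MeasureTheory Matrix

section helpers

variable {d : ℕ} {Ω : Type*} [MeasurableSpace Ω] (μ : Measure Ω) [IsProbabilityMeasure μ]
  (x : Ω → Fin d → ℝ)

theorem abs_coord_mul_le (v : Fin d → ℝ) (i j : Fin d) : |v i * v j| ≤ ∑ i, v i ^ 2 := by
  have h1 : v i ^ 2 ≤ ∑ i, v i ^ 2 :=
    Finset.single_le_sum (f := fun i => v i ^ 2) (fun k _ => sq_nonneg _) (Finset.mem_univ i)
  have h2 : v j ^ 2 ≤ ∑ i, v i ^ 2 :=
    Finset.single_le_sum (f := fun i => v i ^ 2) (fun k _ => sq_nonneg _) (Finset.mem_univ j)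
  rw [abs_le]
  constructor <;> nlinarith [sq_nonneg (v i + v j), sq_nonneg (v i - v j)]

theorem int4 (hmeas : Measurable x) (hx4 : Integrable (fun ω => (∑ i, x ω i ^ 2) ^ 2) μ)
    (i j k l : Fin d) : Integrable (fun ω => x ω i * x ω j * (x ω k * x ω l)) μ := by
  have hm : ∀ i, Measurable fun ω => x ω i := fun i => (measurable_pi_apply i).comp hmeas
  refine hx4.mono' ?_ ?_
  · exact (((hm i).mul (hm j)).mul ((hm k).mul (hm l))).aestronglyMeasurable
  · refine Filter.Eventually.of_forall fun ω => ?_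
    rw [Real.norm_eq_abs, abs_mul, sq]
    exact mul_le_mul (abs_coord_mul_le _ _ _) (abs_coord_mul_le _ _ _) (abs_nonneg _)
      (Finset.sum_nonneg fun _ _ => sq_nonneg _)

theorem int2 (hmeas : Measurable x) (hx4 : Integrable (fun ω => (∑ i, x ω i ^ 2) ^ 2) μ)
    (i j : Fin d) : Integrable (fun ω => x ω i * x ω j) μ := by
  have hm : ∀ i, Measurable fun ω => x ω i := fun i => (measurable_pi_apply i).comp hmeas
  refine ((integrable_const (1 : ℝ)).add hx4).mono' ?_ ?_
  · exact ((hm i).mul (hm j)).aestronglyMeasurable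
  · refine Filter.Eventually.of_forall fun ω => ?_
    rw [Real.norm_eq_abs]
    refine (abs_coord_mul_le _ _ _).trans ?_
    simp only [Pi.add_apply]
    nlinarith [sq_nonneg ((∑ i, x ω i ^ 2) - 1)]

theorem expMatrix_posSemidef (f : Ω → Matrix (Fin d) (Fin d) ℝ)
    (hf : ∀ ω, (f ω).PosSemidef) (hi : ∀ i j, Integrable (fun ω => f ω i j) μ) :
    (expMatrix μ f).PosSemidef := by
  refine Matrix.PosSemidef.of_dotProduct_mulVec_nonneg ?_ ?_
  · ext i j
    simp only [expMatrix, conjTranspose_apply, Matrix.of_apply, star_trivial]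
    refine integral_congr_ae (Filter.Eventually.of_forall fun ω => ?_)
    simpa using (hf ω).1.apply i j
  · intro v
    have : star v ⬝ᵥ (expMatrix μ f) *ᵥ v = ∫ ω, star v ⬝ᵥ (f ω) *ᵥ v ∂μ := by
      simp only [dotProduct, mulVec, expMatrix, Matrix.of_apply]
      rw [integral_finsetSum]
      · refine Finset.sum_congr rfl fun i _ => ?_
        rw [integral_const_mul, integral_finsetSum]
        · simp only [integral_mul_const]
        · intro j _
          exact (hi i j).mul_const _
      · intro i _
        exact (integrable_finsetSum _ fun j _ => (hi i j).mul_const _).const_mul _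
    rw [this]
    exact integral_nonneg fun ω => (hf ω).dotProduct_mulVec_nonneg v

/-- the fourth moment map -/
noncomputable def momM (A : Matrix (Fin d) (Fin d) ℝ) : Matrix (Fin d) (Fin d) ℝ :=
  expMatrix μ fun ω => (x ω ⬝ᵥ A *ᵥ x ω) • vecMulVec (x ω) (x ω)

theorem quad_entry (v : Fin d → ℝ) (A : Matrix (Fin d) (Fin d) ℝ) (i j : Fin d) :
    ((v ⬝ᵥ A *ᵥ v) • vecMulVec v v) i j = ∑ k, ∑ l, A k l * (v k * v l * (v i * v j)) := by
  simp only [Matrix.smul_apply, vecMulVec_apply, smul_eq_mul, dotProduct, mulVec,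
    Finset.sum_mul, Finset.mul_sum]
  refine Finset.sum_congr rfl fun k _ => Finset.sum_congr rfl fun l _ => ?_
  ring

variable {μ x}

theorem momM_int (hmeas : Measurable x)
    (hx4 : Integrable (fun ω => (∑ i, x ω i ^ 2) ^ 2) μ) (A : Matrix (Fin d) (Fin d) ℝ)
    (i j : Fin d) :
    Integrable (fun ω => ((x ω ⬝ᵥ A *ᵥ x ω) • vecMulVec (x ω) (x ω)) i j) μ := by
  simp only [quad_entry]
  exact integrable_finsetSum _ fun k _ => integrable_finsetSum _ fun l _ =>
    (int4 μ x hmeas hx4 k l i j).const_mul _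

theorem momM_apply (hmeas : Measurable x)
    (hx4 : Integrable (fun ω => (∑ i, x ω i ^ 2) ^ 2) μ) (A : Matrix (Fin d) (Fin d) ℝ)
    (i j : Fin d) :
    momM μ x A i j = ∑ k, ∑ l, A k l * ∫ ω, (x ω k * x ω l * (x ω i * x ω j)) ∂μ := by
  simp only [momM, expMatrix, Matrix.of_apply, quad_entry]
  rw [integral_finsetSum]
  · refine Finset.sum_congr rfl fun k _ => ?_
    rw [integral_finsetSum]
    · simp only [integral_const_mul]
    · exact fun l _ => (int4 μ x hmeas hx4 k l i j).const_mul _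
  · exact fun k _ => integrable_finsetSum _ fun l _ =>
      (int4 μ x hmeas hx4 k l i j).const_mul _

theorem momM_add (hmeas : Measurable x)
    (hx4 : Integrable (fun ω => (∑ i, x ω i ^ 2) ^ 2) μ) (A B : Matrix (Fin d) (Fin d) ℝ) :
    momM μ x (A + B) = momM μ x A + momM μ x B := by
  ext i j
  rw [Matrix.add_apply]
  simp only [momM_apply hmeas hx4, Matrix.add_apply, add_mul, Finset.sum_add_distrib]

theorem vv_sandwich (v : Fin d → ℝ) (A : Matrix (Fin d) (Fin d) ℝ) :
    vecMulVec v v * A * vecMulVec v v = (v ⬝ᵥ A *ᵥ v) • vecMulVec v v := by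
  rw [Matrix.mul_assoc, Matrix.mul_vecMulVec, Matrix.vecMulVec_mul_vecMulVec, vecMulVec_smul]

theorem expand (hmeas : Measurable x)
    (hx4 : Integrable (fun ω => (∑ i, x ω i ^ 2) ^ 2) μ)
    (H : Matrix (Fin d) (Fin d) ℝ)
    (hH : H = expMatrix μ fun ω => vecMulVec (x ω) (x ω))
    (C A : Matrix (Fin d) (Fin d) ℝ) (c : ℝ) :
    (∀ i j, Integrable (fun ω =>
      ((C - c • vecMulVec (x ω) (x ω)) * A * (C - c • vecMulVec (x ω) (x ω))) i j) μ) ∧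
    (expMatrix μ fun ω =>
      (C - c • vecMulVec (x ω) (x ω)) * A * (C - c • vecMulVec (x ω) (x ω))) =
      C * A * C - c • (H * (A * C)) - c • (C * A * H) + c ^ 2 • momM μ x A := by
  have e : ∀ ω, (C - c • vecMulVec (x ω) (x ω)) * A * (C - c • vecMulVec (x ω) (x ω))
      = C * A * C - c • (vecMulVec (x ω) (x ω) * (A * C))
        - c • (C * A * vecMulVec (x ω) (x ω))
        + c ^ 2 • ((x ω ⬝ᵥ A *ᵥ x ω) • vecMulVec (x ω) (x ω)) := by
    intro ω
    rw [← vv_sandwich]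
    simp only [Matrix.sub_mul, Matrix.mul_sub, Matrix.smul_mul, Matrix.mul_smul,
      Matrix.mul_assoc, smul_smul, smul_sub, sq]
    abel
  have hv : ∀ i j, Integrable (fun ω => vecMulVec (x ω) (x ω) i j) μ := fun i j => by
    simpa only [vecMulVec_apply] using int2 μ x hmeas hx4 i j
  have i1 : ∀ (D : Matrix (Fin d) (Fin d) ℝ) i j,
      Integrable (fun ω => (vecMulVec (x ω) (x ω) * D) i j) μ := fun D i j => by
    simp only [Matrix.mul_apply]
    exact integrable_finsetSum _ fun k _ => (hv i k).mul_const _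
  have i2 : ∀ (D : Matrix (Fin d) (Fin d) ℝ) i j,
      Integrable (fun ω => (D * vecMulVec (x ω) (x ω)) i j) μ := fun D i j => by
    simp only [Matrix.mul_apply]
    exact integrable_finsetSum _ fun k _ => (hv k j).const_mul _
  have v1 : ∀ (D : Matrix (Fin d) (Fin d) ℝ) i j,
      ∫ ω, (vecMulVec (x ω) (x ω) * D) i j ∂μ = (H * D) i j := fun D i j => by
    simp only [Matrix.mul_apply]
    rw [integral_finsetSum _ fun k _ => (hv i k).mul_const _]
    simp only [integral_mul_const, hH, expMatrix, Matrix.of_apply]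
  have v2 : ∀ (D : Matrix (Fin d) (Fin d) ℝ) i j,
      ∫ ω, (D * vecMulVec (x ω) (x ω)) i j ∂μ = (D * H) i j := fun D i j => by
    simp only [Matrix.mul_apply]
    rw [integral_finsetSum _ fun k _ => (hv k j).const_mul _]
    simp only [integral_const_mul, hH, expMatrix, Matrix.of_apply]
  have i3 := momM_int hmeas hx4 A
  have a1 : ∀ i j, Integrable (fun ω => (C * A * C) i j
      - c * (vecMulVec (x ω) (x ω) * (A * C)) i j) μ := fun i j =>
    (integrable_const _).sub ((i1 _ i j).const_mul c)
  have a2 : ∀ i j, Integrable (fun ω => (C * A * C) i j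
      - c * (vecMulVec (x ω) (x ω) * (A * C)) i j
      - c * (C * A * vecMulVec (x ω) (x ω)) i j) μ := fun i j =>
    (a1 i j).sub ((i2 _ i j).const_mul c)
  have e' : ∀ i j ω,
      ((C - c • vecMulVec (x ω) (x ω)) * A * (C - c • vecMulVec (x ω) (x ω))) i j
      = (C * A * C) i j - c * (vecMulVec (x ω) (x ω) * (A * C)) i j
        - c * (C * A * vecMulVec (x ω) (x ω)) i j
        + c ^ 2 * ((x ω ⬝ᵥ A *ᵥ x ω) • vecMulVec (x ω) (x ω)) i j := by
    intro i j ω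
    rw [e, Matrix.add_apply, Matrix.sub_apply, Matrix.sub_apply, Matrix.smul_apply,
      Matrix.smul_apply, Matrix.smul_apply _ ((x ω ⬝ᵥ A *ᵥ x ω) • vecMulVec (x ω) (x ω))]
    rfl
  constructor
  · intro i j
    simp only [e']
    exact (a2 i j).add ((i3 i j).const_mul _)
  · ext i j
    rw [expMatrix, Matrix.of_apply]
    simp only [e']
    rw [integral_add (a2 i j) ((i3 i j).const_mul _), integral_sub (a1 i j)
      ((i2 _ i j).const_mul c), integral_sub (integrable_const _) ((i1 _ i j).const_mul c),
      integral_const_mul, integral_const_mul, integral_const_mul, v1, v2]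
    simp [momM, expMatrix]

open scoped MatrixOrder Matrix.Norms.L2Operator in
theorem trace_mul_nonneg {A B : Matrix (Fin d) (Fin d) ℝ} (hA : A.PosSemidef)
    (hB : B.PosSemidef) : 0 ≤ (A * B).trace := by
  obtain ⟨C, rfl⟩ := CStarAlgebra.nonneg_iff_eq_star_mul_self.mp hB.nonneg
  rw [Matrix.star_eq_conjTranspose]
  rw [← Matrix.mul_assoc, Matrix.trace_mul_comm, ← Matrix.mul_assoc]
  exact (hA.mul_mul_conjTranspose_same C).trace_nonneg

end helpers

/-- Under the fourth-moment upper condition with constant `α` and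
`0 < η < 1/(α tr H)`, with `B_{0,N} := B₀ − (I−ηH)^N B₀ (I−ηH)^N`,
`Q(A) := E[(I − η x xᵀ) A (I − η x xᵀ)]` and `S_t := ∑_{k<t} Q^k(B₀)`, for every `t ≤ N`:
`S_t ⪯ ∑_{k<t} (I−ηH)^k [ (η α tr(B_{0,N})/(1 − η α tr H)) · H + B₀ ] (I−ηH)^k`. -/
theorem bias_iterates_sum_upper {d : ℕ} {Ω : Type*} [MeasurableSpace Ω]
    (μ : Measure Ω) [IsProbabilityMeasure μ]
    (x : Ω → Fin d → ℝ) (hmeas : Measurable x)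
    (hx4 : Integrable (fun ω => (∑ i, x ω i ^ 2) ^ 2) μ)
    (H : Matrix (Fin d) (Fin d) ℝ)
    (hH : H = expMatrix μ fun ω => vecMulVec (x ω) (x ω))
    (α : ℝ) (hα : 0 < α)
    (hup : ∀ A : Matrix (Fin d) (Fin d) ℝ, A.PosSemidef →
      ((α * (H * A).trace) • H
        - expMatrix μ fun ω => (x ω ⬝ᵥ A *ᵥ x ω) • vecMulVec (x ω) (x ω)).PosSemidef)
    (η : ℝ) (hη0 : 0 < η) (hη1 : η < 1 / (α * H.trace))
    (N : ℕ) (hN : 1 ≤ N)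
    (B₀ : Matrix (Fin d) (Fin d) ℝ) (hB₀ : B₀.PosSemidef)
    (Q : Matrix (Fin d) (Fin d) ℝ → Matrix (Fin d) (Fin d) ℝ)
    (hQ : ∀ A, Q A = expMatrix μ fun ω =>
      (1 - η • vecMulVec (x ω) (x ω)) * A * (1 - η • vecMulVec (x ω) (x ω))) :
    ∀ t ≤ N,
      ((∑ k ∈ Finset.range t, (1 - η • H) ^ k *
          ((η * α * (B₀ - (1 - η • H) ^ N * B₀ * (1 - η • H) ^ N).trace
              / (1 - η * α * H.trace)) • H + B₀) * (1 - η • H) ^ k)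
        - ∑ k ∈ Finset.range t, Q^[k] B₀).PosSemidef := by
  have hHp : H.PosSemidef := by
    rw [hH]
    refine expMatrix_posSemidef μ _ (fun ω => ?_) fun i j => ?_
    · simpa using Matrix.posSemidef_vecMulVec_self_star (x ω)
    · simpa only [vecMulVec_apply] using int2 μ x hmeas hx4 i j
  have hHt : H.transpose = H := by
    have h := hHp.1.eq
    rwa [Matrix.conjTranspose_eq_transpose_of_trivial] at h
  have htr : 0 < H.trace := by
    rcases hHp.trace_nonneg.eq_or_lt with h | h
    · rw [← h] at hη1
      simp at hη1
      linarith
    · exact h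
  have hq : η * α * H.trace < 1 := by
    rw [lt_div_iff₀ (by positivity)] at hη1
    linarith
  have hMH : ∀ A : Matrix (Fin d) (Fin d) ℝ, A.PosSemidef →
      (momM μ x A - H * A * H).PosSemidef := by
    intro A hA
    obtain ⟨h1, h2⟩ := expand hmeas hx4 H hH H A 1
    have h3 := expMatrix_posSemidef μ _ (fun ω => ?_) h1
    · rw [h2] at h3
      convert h3 using 1
      simp only [one_smul, one_pow, Matrix.mul_assoc]
      abel
    · have hs : (H - (1 : ℝ) • vecMulVec (x ω) (x ω))ᴴ
          = H - (1 : ℝ) • vecMulVec (x ω) (x ω) := by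
        simp [hHt, Matrix.transpose_vecMulVec]
      have := hA.conjTranspose_mul_mul_same (H - (1 : ℝ) • vecMulVec (x ω) (x ω))
      rwa [hs] at this
  set P : Matrix (Fin d) (Fin d) ℝ := 1 - η • H with hP
  clear_value P
  have hPt : Pᴴ = P := by simp [hP, hHt]
  have hPk : ∀ k, (P ^ k)ᴴ = P ^ k := fun k => by rw [Matrix.conjTranspose_pow, hPt]
  have hsand : ∀ k (A : Matrix (Fin d) (Fin d) ℝ), A.PosSemidef →
      (P ^ k * A * P ^ k).PosSemidef := fun k A hA => by
    have := hA.conjTranspose_mul_mul_same (P ^ k)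
    rwa [hPk] at this
  have hsand1 : ∀ (A : Matrix (Fin d) (Fin d) ℝ), A.PosSemidef →
      (P * A * P).PosSemidef := fun A hA => by simpa using hsand 1 A hA
  have hQ0 : ∀ A, Q A = A - η • (H * A) - η • (A * H) + η ^ 2 • momM μ x A := fun A => by
    rw [hQ, (expand hmeas hx4 H hH 1 A η).2]
    simp
  have hPAP : ∀ A, P * A * P = A - η • (H * A) - η • (A * H) + η ^ 2 • (H * A * H) := by
    intro A
    simp only [hP, Matrix.sub_mul, Matrix.mul_sub, Matrix.smul_mul, Matrix.mul_smul,
      Matrix.mul_assoc, smul_smul, smul_sub, sq, Matrix.one_mul, Matrix.mul_one]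
    abel
  have hQP : ∀ A, Q A = P * A * P + η ^ 2 • (momM μ x A - H * A * H) := fun A => by
    rw [hQ0, hPAP, smul_sub]
    abel
  have hQlow : ∀ A, A.PosSemidef → (Q A - P * A * P).PosSemidef := fun A hA => by
    rw [hQP, add_sub_cancel_left]
    exact (hMH A hA).smul (sq_nonneg η)
  have hQpos : ∀ A, A.PosSemidef → (Q A).PosSemidef := fun A hA => by
    have := (hQlow A hA).add (hsand1 A hA)
    rwa [sub_add_cancel] at this
  have hQadd : ∀ A B, Q (A + B) = Q A + Q B := fun A B => by
    simp only [hQ0, momM_add hmeas hx4, Matrix.mul_add, Matrix.add_mul, smul_add]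
    abel
  have hQit : ∀ k, (Q^[k] B₀).PosSemidef := fun k => by
    induction k with
    | zero => exact hB₀
    | succ k ih => rw [Function.iterate_succ_apply']; exact hQpos _ ih
  have hlow : ∀ k, (Q^[k] B₀ - P ^ k * B₀ * P ^ k).PosSemidef := fun k => by
    induction k with
    | zero => simpa using Matrix.PosSemidef.zero
    | succ k ih =>
      rw [Function.iterate_succ_apply']
      have := (hQlow _ (hQit k)).add (hsand1 _ ih)
      convert this using 1
      rw [Matrix.mul_sub, Matrix.sub_mul, sub_add_sub_cancel]
      congr 1
      rw [pow_succ' P k]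
      nth_rewrite 2 [← pow_succ' P k]
      rw [pow_succ P k]
      simp only [Matrix.mul_assoc]
  have hS : ∀ t, (∑ k ∈ Finset.range t, Q^[k] B₀).PosSemidef := fun t =>
    Matrix.posSemidef_sum _ fun k _ => hQit k
  have hSs : ∀ t, ∑ k ∈ Finset.range (t + 1), Q^[k] B₀
      = B₀ + Q (∑ k ∈ Finset.range t, Q^[k] B₀) := fun t => by
    induction t with
    | zero => 
      have : Q 0 = 0 := by simpa using hQadd 0 0
      simp [this]
    | succ t ih =>
      conv_lhs => rw [Finset.sum_range_succ, ih]
      conv_rhs => rw [Finset.sum_range_succ, hQadd, ← Function.iterate_succ_apply' Q, ← add_assoc]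
  have hP2 : (1 - P * P).PosSemidef := by
    have h1 := (hup 1 Matrix.PosSemidef.one).add (hMH 1 Matrix.PosSemidef.one)
    have h2 : (α * H.trace) • H - H * H = ((α * (H * 1).trace) • H
        - expMatrix μ fun ω => (x ω ⬝ᵥ (1 : Matrix (Fin d) (Fin d) ℝ) *ᵥ x ω) •
          vecMulVec (x ω) (x ω)) + (momM μ x 1 - H * 1 * H) := by
      rw [momM, Matrix.mul_one, sub_add_sub_cancel]
    rw [← h2] at h1
    have h3 := (h1.smul (sq_nonneg η)).add
      (hHp.smul (show 0 ≤ 2 * η - η ^ 2 * (α * H.trace) by nlinarith))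
    convert h3 using 1
    simp only [hP, Matrix.sub_mul, Matrix.mul_sub, Matrix.smul_mul, Matrix.mul_smul,
      Matrix.one_mul, Matrix.mul_one]
    module
  have hanti : Antitone fun k => (P ^ k * B₀ * P ^ k).trace := by
    refine antitone_nat_of_succ_le fun k => ?_
    have h1 := trace_mul_nonneg hP2 (hsand k B₀ hB₀)
    rw [Matrix.sub_mul, Matrix.trace_sub, Matrix.one_mul] at h1
    have h2 : (P ^ (k + 1) * B₀ * P ^ (k + 1)).trace
        = (P * P * (P ^ k * B₀ * P ^ k)).trace := by
      rw [Matrix.mul_assoc P P, Matrix.trace_mul_comm P]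
      congr 1
      nth_rewrite 1 [pow_succ']
      rw [pow_succ]
      simp only [Matrix.mul_assoc]
    linarith
  have hup' : ∀ A, A.PosSemidef → ((α * (H * A).trace) • H - momM μ x A).PosSemidef := hup
  set b := (B₀ - P ^ N * B₀ * P ^ N).trace with hb
  have hbound : ∀ t ≤ N, η * (H * ∑ k ∈ Finset.range t, Q^[k] B₀).trace
      ≤ b / (1 - η * α * H.trace) := by
    intro t ht
    rw [le_div_iff₀ (by linarith)]
    have h1 := hSs t
    rw [Finset.sum_range_succ] at h1
    have h2 := hS t
    generalize (∑ k ∈ Finset.range t, Q^[k] B₀) = S at h1 h2 ⊢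
    have h3 := congrArg Matrix.trace h1
    rw [hQ0] at h3
    simp only [Matrix.trace_add, Matrix.trace_sub, Matrix.trace_smul, smul_eq_mul] at h3
    rw [Matrix.trace_mul_comm S H] at h3
    have h4 := (hup' S h2).trace_nonneg
    rw [Matrix.trace_sub, Matrix.trace_smul, smul_eq_mul] at h4
    have h5 := (hlow t).trace_nonneg
    rw [Matrix.trace_sub] at h5
    have h6 := hanti ht
    simp only at h6
    have h7 := trace_mul_nonneg hHp h2
    rw [hb, Matrix.trace_sub]
    have h8 := mul_le_mul_of_nonneg_left (sub_nonneg.1 h4) (sq_nonneg η)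
    have h9 := mul_nonneg hη0.le h7
    nlinarith
  intro t
  induction t with
  | zero => intro _; simpa using Matrix.PosSemidef.zero
  | succ t ih =>
    intro ht
    have ht' : t ≤ N := by omega
    have h1 := ih ht'
    have h2 := hbound t ht'
    have h3 := hS t
    rw [hSs t, Finset.sum_range_succ', hQP]
    set c := η * α * b / (1 - η * α * H.trace) with hc
    have hR : ∑ k ∈ Finset.range t, P ^ (k + 1) * (c • H + B₀) * P ^ (k + 1)
        = P * (∑ k ∈ Finset.range t, P ^ k * (c • H + B₀) * P ^ k) * P := by
      rw [Finset.mul_sum, Finset.sum_mul]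
      refine Finset.sum_congr rfl fun k _ => ?_
      nth_rewrite 1 [pow_succ']
      rw [pow_succ]
      simp only [Matrix.mul_assoc]
    rw [hR]
    generalize (∑ k ∈ Finset.range t, Q^[k] B₀) = S at h1 h2 h3 ⊢
    generalize (∑ k ∈ Finset.range t, P ^ k * (c • H + B₀) * P ^ k) = R at h1 ⊢
    have k1 := hsand1 _ h1
    have k2 := (hup' S h3).smul (sq_nonneg η)
    have k3 : (H * S * H).PosSemidef := by
      have := h3.conjTranspose_mul_mul_same H
      rwa [hHp.1] at this
    have k4 := k3.smul (sq_nonneg η)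
    have k5 := hHp.smul (show 0 ≤ c - η ^ 2 * (α * (H * S).trace) by
      have := mul_le_mul_of_nonneg_left h2 (mul_pos hη0 hα).le
      rw [hc, mul_div_assoc]
      nlinarith)
    convert ((k1.add k2).add k4).add k5 using 1
    rw [Matrix.mul_sub, Matrix.sub_mul]
    simp only [pow_zero, Matrix.one_mul, Matrix.mul_one]
    module
end

section
/- Let x be a random vector in ℝ^d with E‖x‖⁴ < ∞ and H := E[x xᵀ]. Suppose there are constants β > 0 with E[x xᵀ A x xᵀ] − H A H ⪰ β · tr(H A) · H for every positive semidefinite A, and R > 0 with E[‖x‖² x xᵀ] ⪯ R² H, and let 0 < η ≤ 1/R². Fix a positive semidefinite matrix B₀, define Q(A) := E[(I − η x xᵀ) A (I − η x xᵀ)] on symmetric matrices and S_t := Σ_{k=0}^{t−1} Q^k(B₀). Then for every even integer t ≥ 2: S_t ⪰ (β/4) · tr( (I − (I − ηH)^{t/2}) B₀ ) · (I − (I − ηH)^{t/2}) + Σ_{k=0}^{t−1} (I − ηH)^k B₀ (I − ηH)^k. -/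
open MeasureTheory Matrix

section helpers
open scoped MatrixOrder

variable {d : ℕ}

lemma biasaux_conj (A G : Matrix (Fin d) (Fin d) ℝ) (hA : 0 ≤ A) (hG : G.IsHermitian) :
    0 ≤ G * A * G := by
  rw [Matrix.nonneg_iff_posSemidef] at *
  have := hA.conjTranspose_mul_mul_same G
  rwa [hG.eq] at this

lemma biasaux_trace (A B : Matrix (Fin d) (Fin d) ℝ) (hA : 0 ≤ A) (hB : 0 ≤ B) :
    0 ≤ (A * B).trace := by
  obtain ⟨C, rfl⟩ := CStarAlgebra.nonneg_iff_eq_star_mul_self.mp hB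
  rw [Matrix.nonneg_iff_posSemidef] at hA
  rw [Matrix.star_eq_conjTranspose]
  rw [← Matrix.mul_assoc, Matrix.trace_mul_comm, ← Matrix.mul_assoc]
  exact (hA.mul_mul_conjTranspose_same C).trace_nonneg

lemma biasaux_smul (c : ℝ) (hc : 0 ≤ c) (A : Matrix (Fin d) (Fin d) ℝ) (hA : 0 ≤ A) :
    0 ≤ c • A := by
  rw [Matrix.nonneg_iff_posSemidef] at *
  exact hA.smul hc

lemma biasaux_sum (m : ℕ) (f : ℕ → ℕ → Matrix (Fin d) (Fin d) ℝ) (hf : ∀ i j, 0 ≤ f i j) :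
    ∑ i ∈ Finset.range m, ∑ j ∈ Finset.range m, f i j
      ≤ ∑ k ∈ Finset.range (2 * m), ∑ j ∈ Finset.range k, f j (k - 1 - j) := by
  rcases m with _ | n
  · simp
  have e : 2 * (n + 1) = (2 * n + 1) + 1 := by ring
  rw [e, Finset.sum_range_succ' _ (2 * n + 1)]
  simp only [Finset.range_zero, Finset.sum_empty, add_zero, Nat.add_sub_cancel]
  rw [← Finset.sum_product' (f := f)]
  rw [← Finset.sum_fiberwise_of_maps_to (s := Finset.range (n+1) ×ˢ Finset.range (n+1))
    (t := Finset.range (2 * n + 1)) (g := fun p => p.1 + p.2)]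
  · apply Finset.sum_le_sum
    intro k _
    rw [← Finset.Nat.sum_antidiagonal_eq_sum_range_succ f k]
    apply Finset.sum_le_sum_of_subset_of_nonneg
    · intro p hp
      simp only [Finset.mem_filter] at hp
      exact Finset.HasAntidiagonal.mem_antidiagonal.mpr hp.2
    · intro p _ _
      exact hf _ _
  · intro p hp
    simp only [Finset.mem_product, Finset.mem_range] at hp ⊢
    omega

/-- the purely algebraic part -/
lemma biasaux_main (H B₀ : Matrix (Fin d) (Fin d) ℝ) (β η : ℝ) (hβ : 0 < β) (hη : 0 < η)
    (hH : 0 ≤ H) (hH2 : 0 ≤ H - η • (H * H)) (hB₀ : 0 ≤ B₀)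
    (Q : Matrix (Fin d) (Fin d) ℝ → Matrix (Fin d) (Fin d) ℝ)
    (hQ : ∀ A, 0 ≤ A →
      (1 - η • H) * A * (1 - η • H) + (η ^ 2 * β * (H * A).trace) • H ≤ Q A) (m : ℕ) :
    (β / 4 * ((1 - (1 - η • H) ^ m) * B₀).trace) • (1 - (1 - η • H) ^ m)
          + ∑ k ∈ Finset.range (2 * m), (1 - η • H) ^ k * B₀ * (1 - η • H) ^ k
      ≤ ∑ k ∈ Finset.range (2 * m), Q^[k] B₀ := by
  have hHh : H.IsHermitian := (Matrix.nonneg_iff_posSemidef.mp hH).isHermitian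
  obtain ⟨G, hGdef⟩ : ∃ G, G = 1 - η • H := ⟨_, rfl⟩
  rw [← hGdef] at hQ
  rw [← hGdef]
  have hG : G.IsHermitian := by
    rw [hGdef]
    exact Matrix.isHermitian_one.sub (by
      unfold Matrix.IsHermitian
      rw [Matrix.conjTranspose_smul, hHh.eq]; simp)
  have hGk : ∀ k, (G ^ k).IsHermitian := fun k => hG.pow k
  have hcomm : Commute G H := by
    rw [hGdef]
    exact (Commute.one_left H).sub_left ((Commute.refl H).smul_left η)
  have hck : ∀ k, Commute (G ^ k) H := fun k => hcomm.pow_left k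
  have hηH : η • H = 1 - G := by rw [hGdef]; abel
  have hGHG : ∀ k, 0 ≤ G ^ k * H * G ^ k := fun k => biasaux_conj _ _ hH (hGk k)
  have hGH : 0 ≤ G * H := by
    have : G * H = H - η • (H * H) := by rw [hGdef, sub_mul, one_mul, smul_mul_assoc]
    rwa [this]
  have hGnH : ∀ n, 0 ≤ G ^ n * H := by
    intro n
    rcases Nat.even_or_odd' n with ⟨k, rfl | rfl⟩
    · have : G ^ (2 * k) * H = G ^ k * H * G ^ k := by
        rw [mul_assoc, ← (hck k).eq, ← mul_assoc, ← pow_add, two_mul]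
      rw [this]; exact hGHG k
    · have : G ^ (2 * k + 1) * H = G ^ k * (G * H) * G ^ k := by
        rw [mul_assoc, mul_assoc, ← (hck k).eq, ← mul_assoc G, ← mul_assoc (G ^ k), ← mul_assoc (G^k),
          ← pow_succ, ← pow_add]
        congr 2; ring
      rw [this]; exact biasaux_conj _ _ hGH (hGk k)
  obtain ⟨a, ha⟩ : ∃ a : ℕ → ℝ, ∀ j, a j = (H * (G ^ j * B₀ * G ^ j)).trace := ⟨_, fun _ => rfl⟩
  have ha0 : ∀ j, 0 ≤ a j := fun j => by
    rw [ha]; exact biasaux_trace _ _ hH (biasaux_conj _ _ hB₀ (hGk j))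
  have hc0 : 0 ≤ η ^ 2 * β := by positivity
  let f : ℕ → ℕ → Matrix (Fin d) (Fin d) ℝ :=
    fun j i => (η ^ 2 * β * a j) • (G ^ i * H * G ^ i)
  have hf : ∀ j i, 0 ≤ f j i := fun j i =>
    biasaux_smul _ (mul_nonneg hc0 (ha0 j)) _ (hGHG i)
  have key : ∀ k, 0 ≤ Q^[k] B₀ ∧
      G ^ k * B₀ * G ^ k + ∑ j ∈ Finset.range k, f j (k - 1 - j) ≤ Q^[k] B₀ := by
    intro k
    induction k with
    | zero => simp [hB₀]
    | succ k ih =>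
      obtain ⟨ih1, ih2⟩ := ih
      rw [Function.iterate_succ_apply']
      set A := Q^[k] B₀ with hA
      have h1 := hQ A ih1
      have htr0 : 0 ≤ (H * A).trace := biasaux_trace _ _ hH ih1
      refine ⟨le_trans (add_nonneg (biasaux_conj _ _ ih1 hG)
        (biasaux_smul _ (mul_nonneg hc0 htr0) _ hH)) h1, ?_⟩
      refine le_trans ?_ h1
      have htr : a k ≤ (H * A).trace := by
        have h2 : 0 ≤ A - G ^ k * B₀ * G ^ k := by
          rw [sub_nonneg]
          exact le_trans (le_add_of_nonneg_right (Finset.sum_nonneg fun j _ => hf _ _)) ih2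
        have := biasaux_trace _ _ hH h2
        rw [mul_sub, Matrix.trace_sub, ← ha] at this
        linarith
      have h3 := biasaux_conj _ _ (sub_nonneg.mpr ih2) hG
      have h4 := biasaux_smul (η ^ 2 * β * ((H * A).trace - a k))
        (mul_nonneg hc0 (sub_nonneg.mpr htr)) _ hH
      have h5 : G ^ (k+1) * B₀ * G ^ (k+1) + ∑ j ∈ Finset.range (k+1), f j (k + 1 - 1 - j)
          = G * (G ^ k * B₀ * G ^ k + ∑ j ∈ Finset.range k, f j (k - 1 - j)) * G
            + (η ^ 2 * β * a k) • H := by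
        rw [Finset.sum_range_succ, mul_add, add_mul, Finset.mul_sum, Finset.sum_mul, add_assoc]
        congr 1
        · rw [pow_succ' G k]
          nth_rewrite 2 [← pow_succ' G k]
          rw [pow_succ]
          simp only [mul_assoc]
        congr 1
        · apply Finset.sum_congr rfl
          intro j hj
          have hj' := Finset.mem_range.mp hj
          have e : k + 1 - 1 - j = (k - 1 - j) + 1 := by omega
          rw [e]
          simp only [f, mul_smul_comm, smul_mul_assoc]
          congr 1
          nth_rewrite 1 [pow_succ']
          rw [pow_succ]
          simp only [mul_assoc]
        · simp [f]
      rw [h5, ← sub_nonneg]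
      have h6 := add_nonneg h3 h4
      convert h6 using 1
      rw [mul_sub G, mul_sub, sub_mul, sub_smul]
      abel
  obtain ⟨T, hT⟩ : ∃ T, T = η • ∑ i ∈ Finset.range m, G ^ i * H * G ^ i := ⟨_, rfl⟩
  obtain ⟨P, hP⟩ : ∃ P, P = 1 - G ^ m := ⟨_, rfl⟩
  rw [← hP]
  have hT0 : 0 ≤ T := by
    rw [hT]; exact biasaux_smul _ hη.le _ (Finset.sum_nonneg fun i _ => hGHG i)
  have hPsum : P = η • ∑ j ∈ Finset.range m, G ^ j * H := by
    rw [hP, Finset.smul_sum, ← geom_sum_mul_neg, Finset.sum_mul]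
    apply Finset.sum_congr rfl
    intro j _
    rw [← hηH, mul_smul_comm]
  have hP0 : 0 ≤ P := by
    rw [hPsum]; exact biasaux_smul _ hη.le _ (Finset.sum_nonneg fun i _ => hGnH i)
  have hGP : 0 ≤ G ^ m * P := by
    rw [hPsum, mul_smul_comm, Finset.mul_sum]
    refine biasaux_smul _ hη.le _ (Finset.sum_nonneg fun i _ => ?_)
    rw [← mul_assoc, ← pow_add]; exact hGnH _
  have hHT : 0 ≤ (1 - G) * T := by
    rw [← hηH, hT, smul_mul_smul_comm, Finset.mul_sum]
    refine biasaux_smul _ (by positivity) _ (Finset.sum_nonneg fun i _ => ?_)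
    have : H * (G ^ i * H * G ^ i) = G ^ i * (H * 1 * H) * G ^ i := by
      rw [mul_assoc (G ^ i), ← mul_assoc H, ← (hck i).eq]; simp only [mul_assoc, mul_one]
      rw [(hck i).eq]
    rw [this]
    refine biasaux_conj _ _ (biasaux_conj _ _ ?_ hHh) (hGk i)
    exact Matrix.nonneg_iff_posSemidef.mpr Matrix.PosSemidef.one
  have hT1 : (1 + G) * T = 1 - G ^ (2 * m) := by
    have e : T = ∑ i ∈ Finset.range m, (1 - G) * (G ^ 2) ^ i := by
      rw [hT, Finset.smul_sum]
      apply Finset.sum_congr rfl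
      intro i _
      rw [(hck i).eq, mul_assoc, ← pow_add, ← hηH, smul_mul_assoc, ← pow_mul, two_mul]
    rw [e, ← Finset.mul_sum, ← mul_assoc, pow_mul, ← mul_neg_geom_sum]
    congr 1
    noncomm_ring
  have h2T : P ≤ (2:ℝ) • T := by
    rw [← sub_nonneg]
    have := add_nonneg hHT hGP
    convert this using 1
    have e1 : (2:ℝ) • T = (1 - G) * T + (1 + G) * T := by
      rw [← add_mul, two_smul]; noncomm_ring
    rw [e1, hT1, hP, mul_sub, mul_one, ← pow_add, two_mul]
    abel
  have htrT : η * ∑ j ∈ Finset.range m, a j = (T * B₀).trace := by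
    rw [hT, smul_mul_assoc, Matrix.trace_smul, smul_eq_mul, Finset.sum_mul, Matrix.trace_sum]
    congr 1
    apply Finset.sum_congr rfl
    intro j _
    rw [ha, ← mul_assoc, Matrix.trace_mul_comm]
    simp only [mul_assoc]
  have htT0 : 0 ≤ (T * B₀).trace := biasaux_trace _ _ hT0 hB₀
  have htP : (P * B₀).trace ≤ 2 * (T * B₀).trace := by
    have := biasaux_trace _ _ (sub_nonneg.mpr h2T) hB₀
    rw [sub_mul, Matrix.trace_sub, smul_mul_assoc, Matrix.trace_smul, smul_eq_mul] at this
    linarith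
  have hprod : ∑ j ∈ Finset.range m, ∑ i ∈ Finset.range m, f j i = (β * (T * B₀).trace) • T := by
    simp only [f]
    simp_rw [← Finset.smul_sum]
    rw [← Finset.sum_smul, ← Finset.mul_sum, ← htrT]
    conv_rhs => rw [hT, smul_smul]
    congr 1
    ring
  have hfin : (β / 4 * (P * B₀).trace) • P ≤ (β * (T * B₀).trace) • T := by
    rw [← sub_nonneg]
    have h1 := biasaux_smul (β * (T * B₀).trace / 2) (by positivity) _ (sub_nonneg.mpr h2T)
    have h2 := biasaux_smul (β / 4 * (2 * (T * B₀).trace - (P * B₀).trace))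
      (mul_nonneg (by positivity) (by linarith)) _ hP0
    convert add_nonneg h1 h2 using 1
    module
  calc _ ≤ (∑ j ∈ Finset.range m, ∑ i ∈ Finset.range m, f j i)
        + ∑ k ∈ Finset.range (2 * m), G ^ k * B₀ * G ^ k := by
        rw [hprod]; gcongr
    _ ≤ (∑ k ∈ Finset.range (2 * m), ∑ j ∈ Finset.range k, f j (k - 1 - j))
        + ∑ k ∈ Finset.range (2 * m), G ^ k * B₀ * G ^ k := by
        gcongr; exact biasaux_sum m f hf
    _ = ∑ k ∈ Finset.range (2 * m), (G ^ k * B₀ * G ^ k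
          + ∑ j ∈ Finset.range k, f j (k - 1 - j)) := by
        rw [Finset.sum_add_distrib, add_comm]
    _ ≤ _ := Finset.sum_le_sum fun k _ => (key k).2

lemma biasaux_sq_le (v : Fin d → ℝ) (i : Fin d) : v i ^ 2 ≤ ∑ k, v k ^ 2 :=
  Finset.single_le_sum (f := fun k => v k ^ 2) (fun k _ => sq_nonneg _) (Finset.mem_univ i)

lemma biasaux_mul_le (v : Fin d → ℝ) (i j : Fin d) : |v i * v j| ≤ ∑ k, v k ^ 2 := by
  have h1 := biasaux_sq_le v i
  have h2 := biasaux_sq_le v j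
  rw [abs_le]
  constructor <;> nlinarith [sq_nonneg (v i + v j), sq_nonneg (v i - v j)]

variable {Ω : Type*} [MeasurableSpace Ω]

lemma biasaux_int4 (μ : Measure Ω)
    (x : Ω → Fin d → ℝ) (hmeas : Measurable x)
    (hx4 : Integrable (fun ω => (∑ i, x ω i ^ 2) ^ 2) μ) (i j k l : Fin d) :
    Integrable (fun ω => (x ω i * x ω j) * (x ω k * x ω l)) μ := by
  have hm : ∀ i, Measurable fun ω => x ω i := fun i => (measurable_pi_apply i).comp hmeas
  refine hx4.mono' (((hm i).mul (hm j)).mul ((hm k).mul (hm l))).aestronglyMeasurable ?_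
  refine Filter.Eventually.of_forall fun ω => ?_
  rw [Real.norm_eq_abs, abs_mul, sq]
  exact mul_le_mul (biasaux_mul_le _ _ _) (biasaux_mul_le _ _ _) (abs_nonneg _)
    (Finset.sum_nonneg fun _ _ => sq_nonneg _)

lemma biasaux_int2 (μ : Measure Ω) [IsProbabilityMeasure μ]
    (x : Ω → Fin d → ℝ) (hmeas : Measurable x)
    (hx4 : Integrable (fun ω => (∑ i, x ω i ^ 2) ^ 2) μ) (i j : Fin d) :
    Integrable (fun ω => x ω i * x ω j) μ := by
  have hm : ∀ i, Measurable fun ω => x ω i := fun i => (measurable_pi_apply i).comp hmeas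
  refine (hx4.add (integrable_const 1)).mono' ((hm i).mul (hm j)).aestronglyMeasurable ?_
  refine Filter.Eventually.of_forall fun ω => ?_
  rw [Real.norm_eq_abs]
  have := biasaux_mul_le (x ω) i j
  simp only [Pi.add_apply]
  nlinarith [sq_nonneg ((∑ i, x ω i ^ 2) - 1)]

lemma biasaux_H (μ : Measure Ω) [IsProbabilityMeasure μ]
    (x : Ω → Fin d → ℝ) (hmeas : Measurable x)
    (hx4 : Integrable (fun ω => (∑ i, x ω i ^ 2) ^ 2) μ) :
    (expMatrix μ fun ω => vecMulVec (x ω) (x ω)).PosSemidef := by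
  refine Matrix.PosSemidef.of_dotProduct_mulVec_nonneg ?_ ?_
  · ext i j
    simp [expMatrix, vecMulVec_apply, mul_comm]
  · intro v
    have : star v ⬝ᵥ (expMatrix μ fun ω => vecMulVec (x ω) (x ω)) *ᵥ v
        = ∫ ω, (∑ i, v i * x ω i) ^ 2 ∂μ := by
      have e : ∀ ω, (∑ i, v i * x ω i) ^ 2 = ∑ i, ∑ j, (v i * v j) * (x ω i * x ω j) := by
        intro ω
        rw [sq, Finset.sum_mul_sum]
        refine Finset.sum_congr rfl fun i _ => Finset.sum_congr rfl fun j _ => by ring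
      simp_rw [e]
      rw [integral_finsetSum _ fun i _ => integrable_finsetSum _ fun j _ =>
        (biasaux_int2 μ x hmeas hx4 i j).const_mul _]
      simp only [dotProduct, mulVec, expMatrix, of_apply, vecMulVec_apply, star_trivial]
      refine Finset.sum_congr rfl fun i _ => ?_
      rw [integral_finsetSum _ fun j _ => (biasaux_int2 μ x hmeas hx4 i j).const_mul _,
        Finset.mul_sum]
      refine Finset.sum_congr rfl fun j _ => ?_
      rw [integral_const_mul]; ring
    rw [this]
    exact integral_nonneg fun ω => sq_nonneg _

lemma biasaux_Q (μ : Measure Ω) [IsProbabilityMeasure μ]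
    (x : Ω → Fin d → ℝ) (hmeas : Measurable x)
    (hx4 : Integrable (fun ω => (∑ i, x ω i ^ 2) ^ 2) μ)
    (H : Matrix (Fin d) (Fin d) ℝ)
    (hH : H = expMatrix μ fun ω => vecMulVec (x ω) (x ω)) (η : ℝ)
    (A : Matrix (Fin d) (Fin d) ℝ) :
    (expMatrix μ fun ω =>
      (1 - η • vecMulVec (x ω) (x ω)) * A * (1 - η • vecMulVec (x ω) (x ω)))
    = (1 - η • H) * A * (1 - η • H) + η ^ 2 •
      ((expMatrix μ fun ω => (x ω ⬝ᵥ A *ᵥ x ω) • vecMulVec (x ω) (x ω)) - H * A * H) := by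
  have e0 : (1 - η • H) * A * (1 - η • H) + η ^ 2 •
      ((expMatrix μ fun ω => (x ω ⬝ᵥ A *ᵥ x ω) • vecMulVec (x ω) (x ω)) - H * A * H)
      = A - η • (H * A) - η • (A * H) +
        η ^ 2 • (expMatrix μ fun ω => (x ω ⬝ᵥ A *ᵥ x ω) • vecMulVec (x ω) (x ω)) := by
    simp only [sub_mul, mul_sub, one_mul, mul_one, smul_mul_assoc, mul_smul_comm]
    module
  have e1 : ∀ ω, (1 - η • vecMulVec (x ω) (x ω)) * A * (1 - η • vecMulVec (x ω) (x ω))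
      = A - η • (vecMulVec (x ω) (x ω) * A) - η • (A * vecMulVec (x ω) (x ω))
        + η ^ 2 • ((x ω ⬝ᵥ A *ᵥ x ω) • vecMulVec (x ω) (x ω)) := by
    intro ω
    have : vecMulVec (x ω) (x ω) * A * vecMulVec (x ω) (x ω)
        = (x ω ⬝ᵥ A *ᵥ x ω) • vecMulVec (x ω) (x ω) := by
      rw [mul_assoc, Matrix.mul_vecMulVec, Matrix.vecMulVec_mul_vecMulVec]
      ext i j
      simp [vecMulVec_apply]; ring
    rw [← this]
    simp only [sub_mul, mul_sub, one_mul, mul_one, smul_mul_assoc, mul_smul_comm]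
    module
  rw [e0]
  simp_rw [e1]
  ext i j
  have i2 := biasaux_int2 μ x hmeas hx4
  have i4 := biasaux_int4 μ x hmeas hx4
  have hI1 : Integrable (fun ω => (vecMulVec (x ω) (x ω) * A) i j) μ := by
    simp only [Matrix.mul_apply, vecMulVec_apply]
    exact integrable_finsetSum _ fun k _ => (i2 i k).mul_const _
  have hI2 : Integrable (fun ω => (A * vecMulVec (x ω) (x ω)) i j) μ := by
    simp only [Matrix.mul_apply, vecMulVec_apply]
    exact integrable_finsetSum _ fun k _ => (i2 k j).const_mul _
  have hI3 : Integrable (fun ω => ((x ω ⬝ᵥ A *ᵥ x ω) • vecMulVec (x ω) (x ω)) i j) μ := by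
    have : (fun ω => ((x ω ⬝ᵥ A *ᵥ x ω) • vecMulVec (x ω) (x ω)) i j)
        = fun ω => ∑ k, ∑ l, A k l * ((x ω k * x ω l) * (x ω i * x ω j)) := by
      ext ω
      simp only [Matrix.smul_apply, vecMulVec_apply, smul_eq_mul, dotProduct, mulVec,
        Finset.sum_mul, Finset.mul_sum]
      refine Finset.sum_congr rfl fun k _ => Finset.sum_congr rfl fun l _ => by ring
    rw [this]
    exact integrable_finsetSum _ fun k _ => integrable_finsetSum _ fun l _ =>
      (i4 k l i j).const_mul _
  have v1 : ∫ ω, (vecMulVec (x ω) (x ω) * A) i j ∂μ = (H * A) i j := by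
    simp only [Matrix.mul_apply, vecMulVec_apply, hH, expMatrix, of_apply]
    rw [integral_finsetSum _ fun k _ => (i2 i k).mul_const _]
    exact Finset.sum_congr rfl fun k _ => integral_mul_const _ _
  have v2 : ∫ ω, (A * vecMulVec (x ω) (x ω)) i j ∂μ = (A * H) i j := by
    simp only [Matrix.mul_apply, vecMulVec_apply, hH, expMatrix, of_apply]
    rw [integral_finsetSum _ fun k _ => (i2 k j).const_mul _]
    exact Finset.sum_congr rfl fun k _ => integral_const_mul _ _
  have step : ∀ (c : ℝ) (f g h : Ω → ℝ), Integrable f μ → Integrable g μ → Integrable h μ →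
      ∫ ω, (c - η * f ω - η * g ω + η ^ 2 * h ω) ∂μ
        = c - η * ∫ ω, f ω ∂μ - η * ∫ ω, g ω ∂μ + η ^ 2 * ∫ ω, h ω ∂μ := by
    intro c f g h hf hg hh
    have hc : Integrable (fun _ : Ω => c) μ := integrable_const c
    have k1 : Integrable (fun ω => c - η * f ω) μ := hc.sub (hf.const_mul η)
    have k2 : Integrable (fun ω => c - η * f ω - η * g ω) μ := k1.sub (hg.const_mul η)
    rw [integral_add k2 (hh.const_mul _), integral_sub k1 (hg.const_mul η),
      integral_sub hc (hf.const_mul η), integral_const_mul, integral_const_mul,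
      integral_const_mul]
    simp
  have := step (A i j) _ _ _ hI1 hI2 hI3
  rw [v1, v2] at this
  simpa [expMatrix] using this

end helpers

/-- Under the fourth-moment lower condition with constant `β`, the bound
`E[‖x‖² x xᵀ] ⪯ R² H`, and `0 < η ≤ 1/R²`, with `Q(A) := E[(I − η x xᵀ) A (I − η x xᵀ)]`
and `S_t := ∑_{k<t} Q^k(B₀)`, for every even `t ≥ 2`:
`S_t ⪰ (β/4) tr((I − (I−ηH)^{t/2}) B₀) · (I − (I−ηH)^{t/2}) + ∑_{k<t} (I−ηH)^k B₀ (I−ηH)^k`. -/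
theorem bias_iterates_sum_lower {d : ℕ} {Ω : Type*} [MeasurableSpace Ω]
    (μ : Measure Ω) [IsProbabilityMeasure μ]
    (x : Ω → Fin d → ℝ) (hmeas : Measurable x)
    (hx4 : Integrable (fun ω => (∑ i, x ω i ^ 2) ^ 2) μ)
    (H : Matrix (Fin d) (Fin d) ℝ)
    (hH : H = expMatrix μ fun ω => vecMulVec (x ω) (x ω))
    (β : ℝ) (hβ : 0 < β)
    (hlow : ∀ A : Matrix (Fin d) (Fin d) ℝ, A.PosSemidef →
      ((expMatrix μ fun ω => (x ω ⬝ᵥ A *ᵥ x ω) • vecMulVec (x ω) (x ω))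
        - H * A * H - (β * (H * A).trace) • H).PosSemidef)
    (R : ℝ) (hR : 0 < R)
    (hRH : ((R ^ 2) • H
      - expMatrix μ fun ω => (∑ k, x ω k ^ 2) • vecMulVec (x ω) (x ω)).PosSemidef)
    (η : ℝ) (hη0 : 0 < η) (hη1 : η ≤ 1 / R ^ 2)
    (B₀ : Matrix (Fin d) (Fin d) ℝ) (hB₀ : B₀.PosSemidef)
    (Q : Matrix (Fin d) (Fin d) ℝ → Matrix (Fin d) (Fin d) ℝ)
    (hQ : ∀ A, Q A = expMatrix μ fun ω =>
      (1 - η • vecMulVec (x ω) (x ω)) * A * (1 - η • vecMulVec (x ω) (x ω))) :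
    ∀ t : ℕ, 2 ≤ t → Even t →
      ((∑ k ∈ Finset.range t, Q^[k] B₀)
        - ((β / 4 * ((1 - (1 - η • H) ^ (t / 2)) * B₀).trace) •
              (1 - (1 - η • H) ^ (t / 2))
          + ∑ k ∈ Finset.range t, (1 - η • H) ^ k * B₀ * (1 - η • H) ^ k)).PosSemidef := by
  intro t _ hev
  obtain ⟨m, rfl⟩ := hev
  have hHp : H.PosSemidef := by rw [hH]; exact biasaux_H μ x hmeas hx4
  have hR2 : ((R ^ 2) • H - H * H).PosSemidef := by
    have h1 := hlow 1 Matrix.PosSemidef.one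
    have e : ∀ ω, x ω ⬝ᵥ (1 : Matrix (Fin d) (Fin d) ℝ) *ᵥ x ω = ∑ k, x ω k ^ 2 := by
      intro ω
      simp [dotProduct, sq]
    simp_rw [e] at h1
    rw [mul_one] at h1
    have h2 := hHp.smul (mul_nonneg hβ.le hHp.trace_nonneg)
    convert (hRH.add h1).add h2 using 1
    abel
  have hηR : 0 ≤ 1 - η * R ^ 2 := by
    have : 0 < R ^ 2 := by positivity
    rw [le_div_iff₀ this] at hη1
    linarith
  have hH2 : (H - η • (H * H)).PosSemidef := by
    convert (hHp.smul hηR).add (hR2.smul hη0.le) using 1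
    module
  have main := biasaux_main H B₀ β η hβ hη0 (Matrix.nonneg_iff_posSemidef.mpr hHp)
    (Matrix.nonneg_iff_posSemidef.mpr hH2) (Matrix.nonneg_iff_posSemidef.mpr hB₀) Q
    (fun A hA => by
      rw [hQ, biasaux_Q μ x hmeas hx4 H hH, Matrix.le_iff]
      have := (hlow A (Matrix.nonneg_iff_posSemidef.mp hA)).smul (sq_nonneg η)
      have e : ∀ U V W : Matrix (Fin d) (Fin d) ℝ,
          U + η ^ 2 • V - (U + (η ^ 2 * β * (H * A).trace) • H)
            = η ^ 2 • (V - (β * (H * A).trace) • H) := by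
        intro U V W
        rw [smul_sub, smul_smul, mul_assoc]
        abel
      rw [e _ _ 0]
      exact this) m
  rw [Matrix.le_iff] at main
  have e1 : (m + m) / 2 = m := by omega
  rw [e1, ← two_mul]
  exact main
end
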